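/- arXiv:1309.5544 — 2 statements merged into one kernel-verified Lean document; each statement's English description precedes it below -/
import Mathlib

section
/- A language L ⊆ Σ* is inductive (Π¹₁) if and only if L is accepted by some alternating Turing machine over Σ. -/
namespace ATMPaper

/-- Actions of a Turing machine: overwrite the scanned symbol by a letter,
move the cursor backward (`left`), or forward (`right`). -/
inductive Act (Γ : Type) : Type
  | write : Γ → Act Γ
  | left : Act Γ
  | right : Act Γ

/-- A cursored tape `u γ̲ v`: the string `u` to the left of the cursor,
the scanned symbol `γ`, and the string `v` to the right. -/
abbrev Tape (Γ : Type) : Type := List Γ × Γ × List Γ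

/-- The scanned symbol of a cursored tape. -/
def Tape.scan {Γ : Type} (t : Tape Γ) : Γ := t.2.1

/-- The effect of an action on a cursored tape (with blank symbol `blank`):
moving forward past the right end extends the tape with a blank, and moving
backward at the left end leaves the cursor in place. -/
inductive ActStep {Γ : Type} (blank : Γ) : Act Γ → Tape Γ → Tape Γ → Prop
  | fwd (u : List Γ) (γ τ : Γ) (v : List Γ) :
      ActStep blank Act.right (u, γ, τ :: v) (u ++ [γ], τ, v)
  | fwdEnd (u : List Γ) (γ : Γ) :
      ActStep blank Act.right (u, γ, []) (u ++ [γ], blank, [])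
  | bwd (u : List Γ) (τ γ : Γ) (v : List Γ) :
      ActStep blank Act.left (u ++ [τ], γ, v) (u, τ, γ :: v)
  | bwdEnd (γ : Γ) (v : List Γ) :
      ActStep blank Act.left ([], γ, v) ([], γ, v)
  | write (u : List Γ) (γ τ : Γ) (v : List Γ) :
      ActStep blank (Act.write τ) (u, γ, v) (u, τ, v)

section Generic

variable {C : Type*} (isE : C → Bool) (step : C → C → Prop)

/-- A chain of steps `c = c₀ → ⋯ → cₙ = c'` (`n ≥ 0`) in which `c₀,…,cₙ₋₁`
are all existential. -/
inductive EChain : C → C → Prop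
  | refl (c : C) : EChain c c
  | step {c c' c'' : C} : isE c = true → step c c' → EChain c' c'' → EChain c c''

/-- A chain of steps `c = c₀ → ⋯ → cₙ = c'` (`n ≥ 0`) in which `c₀,…,cₙ₋₁`
are all universal. -/
inductive UChain : C → C → Prop
  | refl (c : C) : UChain c c
  | step {c c' c'' : C} : isE c = false → step c c' → UChain c' c'' → UChain c c''

/-- `c ⇑∃ c'` : `c'` is universal and reachable from `c` by a chain passing
only through existential configurations. -/
def EPivot (c c' : C) : Prop := EChain isE step c c' ∧ isE c' = false

/-- `c ⇑∀ c'` : `c'` is existential and reachable from `c` by a chain passing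
only through universal configurations. -/
def UPivot (c c' : C) : Prop := UChain isE step c c' ∧ isE c' = true

/-- The set `AC` of accepted configurations: the least set `S` such that
(i) an existential `c` with some pivot `c ⇑∃ c'`, `c' ∈ S`, is in `S`, and
(ii) a universal `c` all of whose pivots `c ⇑∀ c'` lie in `S` is in `S`. -/
inductive Accepted : C → Prop
  | ex {c c' : C} : isE c = true → EPivot isE step c c' → Accepted c' → Accepted c
  | univ {c : C} : isE c = false → (∀ c', UPivot isE step c c' → Accepted c') →
      Accepted c

/-- The set `RC` of rejected configurations: the least set `S` such that
(i) an existential `c` all of whose pivots `c ⇑∃ c'` lie in `S` is in `S`, and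
(ii) a universal `c` with some pivot `c ⇑∀ c'`, `c' ∈ S`, is in `S`. -/
inductive Rejected : C → Prop
  | ex {c : C} : isE c = true → (∀ c', EPivot isE step c c' → Rejected c') →
      Rejected c
  | univ {c c' : C} : isE c = false → UPivot isE step c c' → Rejected c' →
      Rejected c

end Generic

/-- An alternating Turing machine over input alphabet `α`, with (finite)
machine alphabet `Γ` into which `α` embeds, a blank symbol (not a letter
of `α`), a finite set `Q` of states each of which is existential
(`isE q = true`) or universal (`isE q = false`), a start state, and a
transition relation `δ`. -/
structure ATM (α Γ : Type) where
  ΓFin : Finite Γ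
  emb : α ↪ Γ
  blank : Γ
  blank_ne : ∀ a : α, emb a ≠ blank
  Q : Type
  QFin : Finite Q
  isE : Q → Bool
  start : Q
  δ : Q → Γ → Act Γ → Q → Prop

namespace ATM

variable {α Γ : Type} (M : ATM α Γ)

/-- A configuration: a state together with a cursored tape. -/
abbrev Cfg : Type := M.Q × Tape Γ

/-- A configuration is existential or universal according to its state. -/
def cfgE (c : M.Cfg) : Bool := M.isE c.1

/-- The one-step yield relation between configurations. -/
def Yield (c c' : M.Cfg) : Prop :=
  ∃ a : Act Γ, M.δ c.1 (Tape.scan c.2) a c'.1 ∧ ActStep M.blank a c.2 c'.2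

/-- `c ⇑∃ c'` for configurations of `M`. -/
def EPiv (c c' : M.Cfg) : Prop := ATMPaper.EPivot M.cfgE M.Yield c c'

/-- `c ⇑∀ c'` for configurations of `M`. -/
def UPiv (c c' : M.Cfg) : Prop := ATMPaper.UPivot M.cfgE M.Yield c c'

/-- `c` is an accepted configuration of `M`. -/
def Accepted (c : M.Cfg) : Prop := ATMPaper.Accepted M.cfgE M.Yield c

/-- `c` is a rejected configuration of `M`. -/
def Rejected (c : M.Cfg) : Prop := ATMPaper.Rejected M.cfgE M.Yield c

/-- The initial configuration `(s₀, ε, ⊔, w)` for input `w`. -/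
def init (w : List α) : M.Cfg := (M.start, ([], M.blank, w.map M.emb))

/-- `M` accepts the input string `w`. -/
def Accepts (w : List α) : Prop := M.Accepted (M.init w)

/-- `M` rejects the input string `w`. -/
def Rejects (w : List α) : Prop := M.Rejected (M.init w)

/-- The language `L(M)` accepted by `M`. -/
def Lang : Set (List α) := {w | M.Accepts w}

/-- The language `L̄(M)` rejected by `M`. -/
def coLang : Set (List α) := {w | M.Rejects w}

/-- `M` is total: every input is either accepted or rejected. -/
def Total : Prop := ∀ w : List α, M.Accepts w ∨ M.Rejects w

/-- `M` is one-sided: it has no accepted configurations, or no rejected ones. -/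
def OneSided : Prop :=
  (∀ c : M.Cfg, ¬ M.Accepted c) ∨ (∀ c : M.Cfg, ¬ M.Rejected c)

/-- The dual machine: same data, with existential and universal states
interchanged. -/
def dual : ATM α Γ :=
  ⟨M.ΓFin, M.emb, M.blank, M.blank_ne, M.Q, M.QFin,
    fun q => !M.isE q, M.start, M.δ⟩

/-- `M` is alternation well-founded: for no input `w` is there an infinite
sequence of yield-steps from the initial configuration for `w` in which the
type (existential/universal) changes infinitely often. -/
def AltWF : Prop :=
  ∀ w : List α, ¬∃ d : ℕ → M.Cfg, d 0 = M.init w ∧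
    (∀ i : ℕ, M.Yield (d i) (d (i + 1))) ∧
    (∀ n : ℕ, ∃ m : ℕ, n ≤ m ∧ M.cfgE (d m) ≠ M.cfgE (d (m + 1)))

/-- Every chain of yield-steps from an initial configuration of `M` has at
most `k` alternation-pivots, i.e. at most `k` indices at which the type of
the configuration changes. -/
def AltBound (k : ℕ) : Prop :=
  ∀ (w : List α) (n : ℕ) (d : ℕ → M.Cfg), d 0 = M.init w →
    (∀ i < n, M.Yield (d i) (d (i + 1))) →
    ((Finset.range n).filter fun i => M.cfgE (d i) ≠ M.cfgE (d (i + 1))).card ≤ k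

/-- `M` is a `Σ_k` machine: its start state is existential and every chain of
yield-steps from an initial configuration has at most `k` alternation-pivots. -/
def IsSigmaM (k : ℕ) : Prop := M.isE M.start = true ∧ M.AltBound k

/-- `M` is a `Π_k` machine: its start state is universal and every chain of
yield-steps from an initial configuration has at most `k` alternation-pivots;
moreover for `k = 1` no transition rule applies to any existential state. -/
def IsPiM (k : ℕ) : Prop :=
  M.isE M.start = false ∧ M.AltBound k ∧
    (k = 1 → ∀ (q : M.Q) (γ : Γ) (a : Act Γ) (q' : M.Q),
      M.δ q γ a q' → M.isE q = false)

end ATM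

/-- `AltQuant α k b P` is the statement `Q₁ x₁ Q₂ x₂ ⋯ Q_k x_k, P (x₁,…,x_k)`
where the quantifiers `Qᵢ` over `List α` alternate, starting with `∃` if
`b = true` and with `∀` if `b = false`. -/
def AltQuant (α : Type) : (k : ℕ) → Bool → ((Fin k → List α) → Prop) → Prop
  | 0, _, P => P fun i => i.elim0
  | k + 1, true, P => ∃ x : List α, AltQuant α k false fun v => P (Fin.cons x v)
  | k + 1, false, P => ∀ x : List α, AltQuant α k true fun v => P (Fin.cons x v)

/-- `L ⊆ Σ*` is `Σ⁰_k`: definable by `k` alternating quantifiers over strings,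
beginning with `∃`, applied to a computable relation. -/
def IsSigma0 (α : Type) [Primcodable α] (k : ℕ) (L : Set (List α)) : Prop :=
  ∃ R : List α × (Fin k → List α) → Prop, ComputablePred R ∧
    L = {w | AltQuant α k true fun v => R (w, v)}

/-- `L ⊆ Σ*` is `Π⁰_k`: definable by `k` alternating quantifiers over strings,
beginning with `∀`, applied to a computable relation. -/
def IsPi0 (α : Type) [Primcodable α] (k : ℕ) (L : Set (List α)) : Prop :=
  ∃ R : List α × (Fin k → List α) → Prop, ComputablePred R ∧
    L = {w | AltQuant α k false fun v => R (w, v)}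

/-- `L ⊆ Σ*` is inductive (`Π¹₁`): there is a computable relation
`R ⊆ Σ* × List (Σ*)` with
`L = {w | ∀ f : ℕ → Σ*, ∃ n, R (w, [f 0, …, f n])}`. -/
def IsInductive (α : Type) [Primcodable α] (L : Set (List α)) : Prop :=
  ∃ R : List α × List (List α) → Prop, ComputablePred R ∧
    L = {w | ∀ f : ℕ → List α, ∃ n : ℕ, R (w, (List.range (n + 1)).map f)}

/-- A two-tape alternating Turing machine: as `ATM`, but configurations carry
two cursored tapes, and transitions read both scanned symbols and perform an
action on each tape. -/
structure ATM2 (α Γ : Type) where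
  ΓFin : Finite Γ
  emb : α ↪ Γ
  blank : Γ
  blank_ne : ∀ a : α, emb a ≠ blank
  Q : Type
  QFin : Finite Q
  isE : Q → Bool
  start : Q
  δ : Q → Γ → Γ → Act Γ → Act Γ → Q → Prop

namespace ATM2

variable {α Γ : Type} (M : ATM2 α Γ)

/-- A configuration of a two-tape machine: a state and two cursored tapes. -/
abbrev Cfg : Type := M.Q × Tape Γ × Tape Γ

/-- A configuration is existential or universal according to its state. -/
def cfgE (c : M.Cfg) : Bool := M.isE c.1

/-- The one-step yield relation of a two-tape machine. -/
def Yield (c c' : M.Cfg) : Prop :=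
  ∃ a₀ a₁ : Act Γ, M.δ c.1 (Tape.scan c.2.1) (Tape.scan c.2.2) a₀ a₁ c'.1 ∧
    ActStep M.blank a₀ c.2.1 c'.2.1 ∧ ActStep M.blank a₁ c.2.2 c'.2.2

/-- `c ⇑∃ c'` for configurations of `M`. -/
def EPiv (c c' : M.Cfg) : Prop := ATMPaper.EPivot M.cfgE M.Yield c c'

/-- `c ⇑∀ c'` for configurations of `M`. -/
def UPiv (c c' : M.Cfg) : Prop := ATMPaper.UPivot M.cfgE M.Yield c c'

/-- `c` is an accepted configuration of `M`. -/
def Accepted (c : M.Cfg) : Prop := ATMPaper.Accepted M.cfgE M.Yield c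

/-- `c` is a rejected configuration of `M`. -/
def Rejected (c : M.Cfg) : Prop := ATMPaper.Rejected M.cfgE M.Yield c

/-- `M` accepts `w`: the configuration reached after the (deterministic)
pre-processing phase — the start state with the input copied onto both
tapes — is accepted. -/
def Accepts (w : List α) : Prop :=
  M.Accepted (M.start, ([], M.blank, w.map M.emb), ([], M.blank, w.map M.emb))

/-- `M` rejects `w`. -/
def Rejects (w : List α) : Prop :=
  M.Rejected (M.start, ([], M.blank, w.map M.emb), ([], M.blank, w.map M.emb))

end ATM2

/-- The combined two-tape machine `M` of two single-tape machines `M₀`, `M₁`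
over a common alphabet. Its states are triples `⟨q₀,q₁,j⟩` (`j : Bool`, with
`false` for `0` and `true` for `1`), typed according to `q_j`. In control
`j = 0`, a rule `(q₀,γ₀,a,p₀)` of `M₀` acts by `a` on tape `0`, leaves tape `1`
unchanged (re-writing its scanned symbol), and passes to control `0` if `q₀`
and `p₀` are both universal, and to control `1` otherwise; symmetrically, in
control `j = 1`, a rule `(q₁,γ₁,a,p₁)` of `M₁` acts by `a` on tape `1`, leaves
tape `0` unchanged, and passes to control `1` if `q₁` and `p₁` are both
existential, and to control `0` otherwise. -/
def combine {α Γ : Type} (M₀ M₁ : ATM α Γ) : ATM2 α Γ where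
  ΓFin := M₀.ΓFin
  emb := M₀.emb
  blank := M₀.blank
  blank_ne := M₀.blank_ne
  Q := M₀.Q × M₁.Q × Bool
  QFin := by haveI := M₀.QFin; haveI := M₁.QFin; infer_instance
  isE := fun s => cond s.2.2 (M₁.isE s.2.1) (M₀.isE s.1)
  start := (M₀.start, M₁.start, false)
  δ := fun s γ₀ γ₁ a₀ a₁ p =>
    (s.2.2 = false ∧ ∃ p₀ : M₀.Q, M₀.δ s.1 γ₀ a₀ p₀ ∧ a₁ = Act.write γ₁ ∧
        p = (p₀, s.2.1, !(!(M₀.isE s.1) && !(M₀.isE p₀)))) ∨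
    (s.2.2 = true ∧ ∃ p₁ : M₁.Q, M₁.δ s.2.1 γ₁ a₁ p₁ ∧ a₀ = Act.write γ₀ ∧
        p = (s.1, p₁, M₁.isE s.2.1 && M₁.isE p₁))

end ATMPaper

namespace ATMPaper

section Generic

variable {C : Type*} {isE : C → Bool} {step : C → C → Prop}

theorem Accepted.of_step_existential {c c' : C} (hc : isE c = true) (h : step c c')
    (h' : Accepted isE step c') : Accepted isE step c := by
  cases h' with
  | ex h₁ h₂ h₃ => exact .ex hc ⟨.step hc h h₂.1, h₂.2⟩ h₃
  | univ h₁ h₂ => exact .ex hc ⟨.step hc h (.refl _), h₁⟩ (.univ h₁ h₂)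

/-- A set of universal configurations all of whose successors are accepted or remain in the
set consists of accepted configurations. -/
theorem Accepted.of_universal_invariant {S : C → Prop}
    (hS : ∀ c, S c → isE c = false ∧ ∀ c', step c c' → S c' ∨ Accepted isE step c')
    {c : C} (hc : S c) : Accepted isE step c := by
  refine .univ (hS c hc).1 fun c' hc' => ?_
  obtain ⟨hchain, hE⟩ := hc'
  induction hchain with
  | refl c => simp [(hS c hc).1] at hE
  | step h₁ h₂ h₃ ih =>
    rcases (hS _ hc).2 _ h₂ with h | h
    · exact ih h hE
    · cases h with
      | ex h₄ =>
        cases h₃ with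
        | refl => exact .ex h₄ ‹_› ‹_›
        | step h₅ => simp [h₄] at h₅
      | univ h₄ h₅ => exact h₅ _ ⟨h₃, hE⟩

theorem Accepted.sound {P : C → Prop}
    (hE : ∀ c c', isE c = true → step c c' → P c' → P c)
    (hU : ∀ c, isE c = false → ¬ P c → ∃ c', UPivot isE step c c' ∧ ¬ P c')
    {c : C} (hc : Accepted isE step c) : P c := by
  induction hc with
  | ex h₁ h₂ h₃ ih =>
    obtain ⟨hchain, -⟩ := h₂
    clear h₁ h₃
    induction hchain with
    | refl => exact ih
    | step h₁ h₂ _ ih' => exact hE _ _ h₁ h₂ (ih' ih)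
  | univ h₁ _ ih =>
    by_contra h
    obtain ⟨c', h₂, h₃⟩ := hU _ h₁ h
    exact h₃ (ih c' h₂)

variable {D : Type*} {isE' : D → Bool} {step' : D → D → Prop}

/-- Acceptance is preserved and reflected by functional bisimulations. -/
theorem accepted_iff_of_bisimulation (φ : C → D) (hφ : ∀ c, isE' (φ c) = isE c)
    (h₁ : ∀ c c', step c c' → step' (φ c) (φ c'))
    (h₂ : ∀ c d, step' (φ c) d → ∃ c', step c c' ∧ φ c' = d) (c : C) :
    Accepted isE step c ↔ Accepted isE' step' (φ c) := by
  have liftE : ∀ {d d'}, EChain isE' step' d d' → ∀ c, φ c = d →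
      ∃ c', EChain isE step c c' ∧ φ c' = d' := by
    intro d d' h
    induction h with
    | refl d => exact fun c hc => ⟨c, .refl c, hc⟩
    | step h₃ h₄ _ ih =>
      rintro c rfl
      obtain ⟨c₁, h₅, h₆⟩ := h₂ _ _ h₄
      obtain ⟨c', h₇, h₈⟩ := ih c₁ h₆
      exact ⟨c', .step (by rw [← hφ, h₃]) h₅ h₇, h₈⟩
  have liftU : ∀ {d d'}, UChain isE' step' d d' → ∀ c, φ c = d →
      ∃ c', UChain isE step c c' ∧ φ c' = d' := by
    intro d d' h
    induction h with
    | refl d => exact fun c hc => ⟨c, .refl c, hc⟩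
    | step h₃ h₄ _ ih =>
      rintro c rfl
      obtain ⟨c₁, h₅, h₆⟩ := h₂ _ _ h₄
      obtain ⟨c', h₇, h₈⟩ := ih c₁ h₆
      exact ⟨c', .step (by rw [← hφ, h₃]) h₅ h₇, h₈⟩
  have mapE : ∀ {c c'}, EChain isE step c c' → EChain isE' step' (φ c) (φ c') := by
    intro c c' h
    induction h with
    | refl => exact .refl _
    | step h₃ h₄ _ ih => exact .step (by rw [hφ, h₃]) (h₁ _ _ h₄) ih
  have mapU : ∀ {c c'}, UChain isE step c c' → UChain isE' step' (φ c) (φ c') := by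
    intro c c' h
    induction h with
    | refl => exact .refl _
    | step h₃ h₄ _ ih => exact .step (by rw [hφ, h₃]) (h₁ _ _ h₄) ih
  constructor
  · intro h
    induction h with
    | ex h₃ h₄ _ ih => exact .ex (by rw [hφ, h₃]) ⟨mapE h₄.1, by rw [hφ, h₄.2]⟩ ih
    | univ h₃ _ ih =>
      refine .univ (by rw [hφ, h₃]) fun d hd => ?_
      obtain ⟨c', h₅, rfl⟩ := liftU hd.1 _ rfl
      exact ih c' ⟨h₅, by rw [← hφ, hd.2]⟩
  · generalize hd : φ c = d
    intro h
    induction h generalizing c with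
    | ex h₃ h₄ _ ih =>
      obtain ⟨c', h₅, rfl⟩ := liftE h₄.1 c hd
      exact .ex (by rw [← hφ, hd, h₃]) ⟨h₅, by rw [← hφ, h₄.2]⟩ (ih c' rfl)
    | univ h₃ _ ih =>
      subst hd
      exact .univ (by rw [← hφ, h₃]) fun c' h₅ =>
        ih (φ c') ⟨mapU h₅.1, by rw [hφ, h₅.2]⟩ c' rfl

end Generic

/-- The tape obtained by performing an action. -/
def Tape.act {Γ : Type} (blank : Γ) : Act Γ → Tape Γ → Tape Γ
  | .right, t => (t.1 ++ [t.2.1], t.2.2.headD blank, t.2.2.tail)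
  | .left, t =>
    t.1.reverse.head?.elim t fun τ => (t.1.reverse.tail.reverse, τ, t.2.1 :: t.2.2)
  | .write τ, t => (t.1, τ, t.2.2)

theorem actStep_iff {Γ : Type} (blank : Γ) (a : Act Γ) (t t' : Tape Γ) :
    ActStep blank a t t' ↔ t' = Tape.act blank a t := by
  constructor
  · rintro (_ | _ | _ | _ | _) <;> simp [Tape.act]
  · rintro rfl
    obtain ⟨u, γ, v⟩ := t
    rcases a with τ | _ | _
    · exact .write ..
    · rcases List.eq_nil_or_concat u with rfl | ⟨u, τ, rfl⟩
      · exact .bwdEnd ..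
      · simpa [Tape.act] using ActStep.bwd u τ γ v
    · rcases v with _ | ⟨τ, v⟩
      · exact .fwdEnd ..
      · exact .fwd ..

/-- A tape as a head position together with the contents of the infinitely many cells. -/
def Tape.cells {Γ : Type} (blank : Γ) (t : Tape Γ) : ℕ × (ℕ → Γ) :=
  (t.1.length, fun n => (t.1 ++ t.2.1 :: t.2.2).getD n blank)

/-- The effect of an action on a head position and cell contents. -/
def moveCells {Γ : Type} : Act Γ → ℕ × (ℕ → Γ) → ℕ × (ℕ → Γ)
  | .right, t => (t.1 + 1, t.2)
  | .left, t => (t.1 - 1, t.2)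
  | .write τ, t => (t.1, Function.update t.2 t.1 τ)

theorem cells_scan {Γ : Type} (blank : Γ) (t : Tape Γ) :
    (t.cells blank).2 (t.cells blank).1 = t.scan := by
  simp [Tape.cells, Tape.scan]

theorem cells_act {Γ : Type} (blank : Γ) (a : Act Γ) (t : Tape Γ) :
    (t.act blank a).cells blank = moveCells a (t.cells blank) := by
  obtain ⟨u, γ, v⟩ := t
  rcases a with τ | _ | _
  · refine Prod.ext rfl (funext fun n => ?_)
    simp only [Tape.act, Tape.cells, moveCells, Function.update_apply, List.getD_eq_getElem?_getD]
    split_ifs with h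
    · simp [h]
    · rcases lt_or_gt_of_ne h with h | h
      · simp [List.getElem?_append_left h]
      · obtain ⟨k, rfl⟩ := Nat.exists_eq_add_of_lt h
        simp [add_assoc, List.getElem?_append_right]
  · rcases List.eq_nil_or_concat u with rfl | ⟨u, τ, rfl⟩
    · rfl
    · simp [Tape.act, Tape.cells, moveCells]
  · rcases v with _ | ⟨τ, v⟩
    · refine Prod.ext (by simp [Tape.act, Tape.cells, moveCells]) (funext fun n => ?_)
      simp only [Tape.act, Tape.cells, moveCells, List.getD_eq_getElem?_getD]
      rcases lt_or_ge n (u ++ [γ]).length with h | h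
      · rw [List.getElem?_append_left h]
      · rw [List.getElem?_append_right h, List.getElem?_eq_none (l := u ++ [γ]) h]
        cases n - (u ++ [γ]).length <;> simp
    · simp [Tape.act, Tape.cells, moveCells]

namespace ATM

variable {α Γ : Type} (M : ATM α Γ)

/-- The yield relation on configurations presented by head position and cell contents. -/
def CellYield (c c' : M.Q × ℕ × (ℕ → Γ)) : Prop :=
  ∃ a, M.δ c.1 (c.2.2 c.2.1) a c'.1 ∧ c'.2 = moveCells a c.2

theorem accepted_iff_cells (c : M.Cfg) :
    M.Accepted c ↔
      ATMPaper.Accepted (fun c => M.isE c.1) M.CellYield (c.1, c.2.cells M.blank) := by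
  refine accepted_iff_of_bisimulation (isE' := fun c => M.isE c.1) (step' := M.CellYield)
    (fun c : M.Cfg => (c.1, c.2.cells M.blank)) (fun c => rfl) ?_ ?_ c
  · rintro c c' ⟨a, h₁, h₂⟩
    rw [actStep_iff] at h₂
    exact ⟨a, by simpa only [cells_scan] using h₁, by simp only [h₂, cells_act]⟩
  · rintro c ⟨q, t⟩ ⟨a, h₁, h₂⟩
    refine ⟨(q, c.2.act M.blank a), ⟨a, by simpa only [cells_scan] using h₁, ?_⟩, ?_⟩
    · rw [actStep_iff]
    · exact Prod.ext rfl (by rw [h₂]; exact cells_act ..)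

end ATM
end ATMPaper

namespace ATMPaper

open Function

/-- The letter of `w` at a position, where position `0` is the left end mark (`none`) and
positions beyond the end of `w` are blank (`some none`). -/
def label {α : Type} (w : List α) : ℕ → Option (Option α)
  | 0 => none
  | n + 1 => some w[n]?

/-- Rules of an alternating register program with states in `Q`: equality, successor and letter
tests, binary branching and guessing the content of a register (both existential for `true` and
universal for `false`), and calls to an arbitrary predicate. -/
inductive Rule (α Q : Type) : Type
  | eq (i j : ℕ)
  | succ (i j : ℕ)
  | lab (i : ℕ) (x : Option (Option α))
  | branch (b : Bool) (q r : Q)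
  | guess (b : Bool) (i : ℕ) (q : Q)
  | call (P : List α → (ℕ → ℕ) → Prop)

namespace Rule

variable {α Q Q' : Type}

/-- The meaning of a rule, given the meaning of the states. -/
def Sem (w : List α) (X : Q → (ℕ → ℕ) → Prop) : Rule α Q → (ℕ → ℕ) → Prop
  | eq i j, ρ => ρ i = ρ j
  | succ i j, ρ => ρ j = ρ i + 1
  | lab i x, ρ => label w (ρ i) = x
  | branch true q r, ρ => X q ρ ∨ X r ρ
  | branch false q r, ρ => X q ρ ∧ X r ρ
  | guess true i q, ρ => ∃ n, X q (update ρ i n)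
  | guess false i q, ρ => ∀ n, X q (update ρ i n)
  | call P, ρ => P w ρ

/-- Rename the states of a rule. -/
def map (e : Q → Q') : Rule α Q → Rule α Q'
  | eq i j => eq i j
  | succ i j => succ i j
  | lab i x => lab i x
  | branch b q r => branch b (e q) (e r)
  | guess b i q => guess b i (e q)
  | call P => call P

theorem sem_map (w : List α) (e : Q → Q') (X : Q' → (ℕ → ℕ) → Prop) (r : Rule α Q)
    (ρ : ℕ → ℕ) : (r.map e).Sem w X ρ ↔ r.Sem w (fun q => X (e q)) ρ := by
  rcases r with _ | _ | _ | ⟨_ | _, _, _⟩ | ⟨_ | _, _, _⟩ | _ <;> rfl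

theorem Sem.mono {w : List α} {X Y : Q → (ℕ → ℕ) → Prop} (h : ∀ q ρ, X q ρ → Y q ρ)
    {r : Rule α Q} {ρ : ℕ → ℕ} (hr : r.Sem w X ρ) : r.Sem w Y ρ := by
  rcases r with _ | _ | _ | ⟨_ | _, _, _⟩ | ⟨_ | _, _, _⟩ | _
  · exact hr
  · exact hr
  · exact hr
  · exact ⟨h _ _ hr.1, h _ _ hr.2⟩
  · exact hr.imp (h _ _) (h _ _)
  · exact fun n => h _ _ (hr n)
  · exact hr.imp fun n => h _ _
  · exact hr

end Rule

/-- The least family of predicates satisfying the rules of a register program. -/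
def Holds {α Q : Type} (rule : Q → Rule α Q) (w : List α) (q : Q) (ρ : ℕ → ℕ) : Prop :=
  ∀ X : Q → (ℕ → ℕ) → Prop, (∀ q ρ, (rule q).Sem w X ρ → X q ρ) → X q ρ

namespace Holds

variable {α Q Q' : Type} {rule : Q → Rule α Q} {w : List α} {q : Q} {ρ : ℕ → ℕ}

theorem mk (h : (rule q).Sem w (Holds rule w) ρ) : Holds rule w q ρ :=
  fun X hX => hX _ _ (h.mono fun _ _ h' => h' X hX)

theorem sem (h : Holds rule w q ρ) : (rule q).Sem w (Holds rule w) ρ :=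
  h (fun q ρ => (rule q).Sem w (Holds rule w) ρ) fun _ _ h' => h'.mono fun _ _ => mk

theorem iff_sem : Holds rule w q ρ ↔ (rule q).Sem w (Holds rule w) ρ :=
  ⟨sem, mk⟩

theorem map_iff {rule' : Q' → Rule α Q'} (e : Q → Q')
    (he : ∀ q, rule' (e q) = (rule q).map e) :
    Holds rule' w (e q) ρ ↔ Holds rule w q ρ := by
  constructor
  · intro h
    refine h (fun q' ρ => ∀ q, e q = q' → Holds rule w q ρ) ?_ q rfl
    rintro _ ρ h q rfl
    rw [he, Rule.sem_map] at h
    exact mk (h.mono fun q ρ h' => h' q rfl)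
  · intro h
    refine h (fun q ρ => Holds rule' w (e q) ρ) fun q ρ h => mk ?_
    rwa [he, Rule.sem_map]

end Holds

/-- Predicates defined by finite register programs without calls. -/
def Definable {α : Type} (P : List α → (ℕ → ℕ) → Prop) : Prop :=
  ∃ (Q : Type) (_ : Finite Q) (rule : Q → Rule α Q) (q : Q),
    (∀ q P, rule q ≠ .call P) ∧ ∀ w ρ, Holds rule w q ρ ↔ P w ρ

namespace Definable

variable {α : Type} {P P' : List α → (ℕ → ℕ) → Prop}

theorem of_iff (h : Definable P) (h' : ∀ w ρ, P w ρ ↔ P' w ρ) : Definable P' := by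
  obtain ⟨Q, hQ, rule, q, h₁, h₂⟩ := h
  exact ⟨Q, hQ, rule, q, h₁, fun w ρ => (h₂ w ρ).trans (h' w ρ)⟩

/-- Programs calling definable predicates can be expanded to programs without calls. -/
theorem of_program {Q : Type} [Finite Q] (rule : Q → Rule α Q)
    (h : ∀ q P, rule q = .call P → Definable P) (q : Q) :
    Definable fun w ρ => Holds rule w q ρ := by
  have key : ∀ q, ∃ (X : Type) (_ : Finite X) (ruleX : X → Rule α X) (x : X),
      (∀ x P, ruleX x ≠ .call P) ∧
        ∀ P, rule q = .call P → ∀ w ρ, Holds ruleX w x ρ ↔ P w ρ := by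
    intro q
    by_cases hq : ∃ P, rule q = .call P
    · obtain ⟨P, hP⟩ := hq
      obtain ⟨X, hX, ruleX, x, h₁, h₂⟩ := h q P hP
      refine ⟨X, hX, ruleX, x, h₁, fun P' hP' => ?_⟩
      rw [hP] at hP'
      cases hP'
      exact h₂
    · exact ⟨Unit, inferInstance, fun _ => .eq 0 0, (), by simp, fun P hP => (hq ⟨P, hP⟩).elim⟩
  choose X hX ruleX x h₁ h₂ using key
  let rule' : Q ⊕ (Σ q, X q) → Rule α (Q ⊕ (Σ q, X q)) := Sum.elim
    (fun q => match rule q with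
      | .call _ => .branch true (.inr ⟨q, x q⟩) (.inr ⟨q, x q⟩)
      | r => r.map .inl)
    (fun y => (ruleX y.1 y.2).map fun z => .inr ⟨y.1, z⟩)
  have rule'_of_ne : ∀ q, (∀ P, rule q ≠ .call P) → rule' (.inl q) = (rule q).map .inl := by
    intro q hq
    simp only [rule', Sum.elim_inl]
  have rule'_of_eq : ∀ q P, rule q = .call P →
      rule' (.inl q) = .branch true (.inr ⟨q, x q⟩) (.inr ⟨q, x q⟩) := by
    intro q P hq
    simp only [rule', Sum.elim_inl, hq]
  have inr_iff : ∀ q y w ρ, Holds rule' w (.inr ⟨q, y⟩) ρ ↔ Holds (ruleX q) w y ρ :=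
    fun q y w ρ => Holds.map_iff (fun z => (Sum.inr ⟨q, z⟩ : Q ⊕ (Σ q, X q))) fun _ => rfl
  refine ⟨_, inferInstance, rule', .inl q, ?_, fun w ρ => ⟨fun hq => ?_, fun hq => ?_⟩⟩
  · rintro (q | ⟨q, y⟩) P hP
    · by_cases hq : ∃ P, rule q = .call P
      · obtain ⟨P', hP'⟩ := hq
        simp [rule'_of_eq q P' hP'] at hP
      · push Not at hq
        rw [rule'_of_ne q hq] at hP
        cases hr : rule q <;> simp_all [Rule.map]
    · simp only [rule', Sum.elim_inr] at hP
      cases hr : ruleX q y <;> simp_all [Rule.map]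
  · refine hq (Sum.elim (Holds rule w) fun y => Holds rule' w (.inr y)) ?_
    rintro (q | ⟨q, y⟩) ρ hY
    · by_cases hq : ∃ P, rule q = .call P
      · obtain ⟨P, hP⟩ := hq
        rw [rule'_of_eq q P hP] at hY
        simp only [Rule.Sem, Sum.elim_inr, or_self] at hY
        rw [inr_iff, h₂ q P hP] at hY
        exact Holds.mk (by rwa [hP])
      · push Not at hq
        rw [rule'_of_ne q hq, Rule.sem_map] at hY
        exact Holds.mk hY
    · simp only [rule', Sum.elim_inr, Rule.sem_map] at hY
      refine Holds.mk ?_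
      simpa only [rule', Sum.elim_inr, Rule.sem_map] using hY
  · refine hq (fun q ρ => Holds rule' w (.inl q) ρ) fun q ρ hY => ?_
    by_cases hq : ∃ P, rule q = .call P
    · obtain ⟨P, hP⟩ := hq
      refine Holds.mk ?_
      rw [rule'_of_eq q P hP]
      rw [hP] at hY
      simp only [Rule.Sem, or_self]
      rw [inr_iff, h₂ q P hP]
      exact hY
    · push Not at hq
      refine Holds.mk ?_
      rwa [rule'_of_ne q hq, Rule.sem_map]

theorem of_rule (r : Rule α Unit) (h : ∀ P, r ≠ .call P) :
    Definable fun w ρ => r.Sem w (fun _ => Holds (fun _ => r) w ()) ρ :=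
  (of_program (fun _ : Unit => r) (fun _ _ h' => (h _ h').elim) ()).of_iff fun _ _ =>
    Holds.iff_sem

theorem eq (i j : ℕ) : Definable fun (_ : List α) ρ => ρ i = ρ j :=
  of_rule (.eq i j) (by simp)

theorem succ (i j : ℕ) : Definable fun (_ : List α) ρ => ρ j = ρ i + 1 :=
  of_rule (.succ i j) (by simp)

theorem lab (i : ℕ) (x : Option (Option α)) : Definable fun w ρ => label w (ρ i) = x :=
  of_rule (.lab i x) (by simp)

theorem branch (b : Bool) (hP : Definable P) (hP' : Definable P') :
    Definable fun w ρ => cond b (P w ρ ∨ P' w ρ) (P w ρ ∧ P' w ρ) := by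
  refine (of_program (fun q : Option Bool =>
    q.elim (.branch b (some true) (some false)) fun c => .call (cond c P P')) ?_ none).of_iff ?_
  · rintro (_ | _ | _) R hR <;> cases hR <;> assumption
  · intro w ρ
    cases b <;> simp [Holds.iff_sem, Rule.Sem]

theorem and (hP : Definable P) (hP' : Definable P') : Definable fun w ρ => P w ρ ∧ P' w ρ :=
  branch false hP hP'

theorem or (hP : Definable P) (hP' : Definable P') : Definable fun w ρ => P w ρ ∨ P' w ρ :=
  branch true hP hP'

theorem guess (b : Bool) (i : ℕ) (hP : Definable P) :
    Definable fun w ρ => cond b (∃ n, P w (update ρ i n)) (∀ n, P w (update ρ i n)) := by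
  refine (of_program (fun q : Bool =>
    cond q (.guess b i false) (.call P)) ?_ true).of_iff ?_
  · rintro (_ | _) R hR <;> cases hR
    assumption
  · intro w ρ
    cases b <;> simp [Holds.iff_sem, Rule.Sem]

theorem exists_fresh {P : List α → (ℕ → ℕ) → ℕ → Prop} (k : ℕ)
    (hk : ∀ w ρ n x, P w (update ρ k n) x ↔ P w ρ x) (h : Definable fun w ρ => P w ρ (ρ k)) :
    Definable fun w ρ => ∃ x, P w ρ x :=
  (guess true k h).of_iff fun w ρ => by simp [hk]

theorem forall_fresh {P : List α → (ℕ → ℕ) → ℕ → Prop} (k : ℕ)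
    (hk : ∀ w ρ n x, P w (update ρ k n) x ↔ P w ρ x) (h : Definable fun w ρ => P w ρ (ρ k)) :
    Definable fun w ρ => ∀ x, P w ρ x :=
  (guess false k h).of_iff fun w ρ => by simp [hk]

end Definable
end ATMPaper

namespace ATMPaper

open Function

/-- A cell of the tape: its label, and the set of registers marking it. -/
abbrev Cell (α : Type) (K : ℕ) : Type := Option (Option α) × Set (Fin K)

namespace Cell

variable {α : Type} {K : ℕ}

/-- Register `i` marks the cell. -/
def Marks (i : ℕ) (γ : Cell α K) : Prop := ∃ k ∈ γ.2, (k : ℕ) = i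

/-- Remove the mark of register `i`. -/
def erase (i : ℕ) (γ : Cell α K) : Cell α K := (γ.1, {k | k ∈ γ.2 ∧ (k : ℕ) ≠ i})

/-- Add the mark of register `i`. -/
def put (i : ℕ) (γ : Cell α K) : Cell α K := (γ.1, {k | k ∈ γ.2 ∨ (k : ℕ) = i})

end Cell

/-- The tape contents representing a word and a valuation of the registers below `K`. -/
def encodeTape {α : Type} (K : ℕ) (w : List α) (ρ : ℕ → ℕ) (n : ℕ) : Cell α K :=
  (label w n, {k | ρ k = n})

section encodeTape

variable {α : Type} {K : ℕ} {w : List α} {ρ : ℕ → ℕ} {i n : ℕ}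

theorem marks_encodeTape (hi : i < K) : (encodeTape K w ρ n).Marks i ↔ ρ i = n := by
  constructor
  · rintro ⟨k, hk, rfl⟩
    exact hk
  · exact fun h => ⟨⟨i, hi⟩, h, rfl⟩

theorem update_encodeTape_erase :
    update (encodeTape K w ρ) (ρ i) ((encodeTape K w ρ (ρ i)).erase i) =
      fun n => (encodeTape K w ρ n).erase i := by
  funext n
  by_cases h : n = ρ i
  · subst h
    simp
  · rw [update_of_ne h]
    refine Prod.ext rfl (Set.ext fun k => ?_)
    simp only [encodeTape, Cell.erase, Set.mem_ofPred_eq]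
    refine ⟨fun hk => ⟨hk, ?_⟩, And.left⟩
    rintro rfl
    exact h hk.symm

theorem update_erase_put (p : ℕ) :
    update (fun n => (encodeTape K w ρ n).erase i) p
      (((encodeTape K w ρ p).erase i).put i) = encodeTape K w (update ρ i p) := by
  funext n
  by_cases h : n = p
  · subst h
    rw [update_self]
    refine Prod.ext rfl (Set.ext fun k => ?_)
    by_cases hk : (k : ℕ) = i <;> simp [encodeTape, Cell.erase, Cell.put, update_apply, hk]
  · rw [update_of_ne h]
    refine Prod.ext rfl (Set.ext fun k => ?_)
    by_cases hk : (k : ℕ) = i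
    · simp [encodeTape, Cell.erase, hk, Ne.symm h]
    · simp [encodeTape, Cell.erase, update_apply, hk]

end encodeTape

/-- States of the machine evaluating a register program: each program state has two phases. -/
inductive EvalState (Q : Type) : Type
  | start
  | accept
  | node (q : Q) (phase : Bool)

instance {Q : Type} [Finite Q] : Finite (EvalState Q) :=
  Finite.of_injective
    (fun s : EvalState Q => match s with
      | .start => (none : Option (Option (Q × Bool)))
      | .accept => some none
      | .node q b => some (some (q, b)))
    (by rintro (_ | _ | _) (_ | _ | _) h <;> simp_all)

/-- The type of a state in the second phase is determined by the rule. -/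
def Rule.isExistential {α Q : Type} : Rule α Q → Bool
  | .branch b _ _ => b
  | .guess b _ _ => b
  | _ => true

/-- All registers mentioned by a rule are below `K`. -/
def Rule.Below {α Q : Type} (K : ℕ) : Rule α Q → Prop
  | .eq i j => i < K ∧ j < K
  | .succ i j => i < K ∧ j < K
  | .lab i _ => i < K
  | .guess _ i _ => i < K
  | _ => True

theorem Rule.exists_below {α Q : Type} [Finite Q] (rule : Q → Rule α Q) :
    ∃ K, ∀ q, (rule q).Below K := by
  have h : ∀ q, ∃ K, ∀ K' ≥ K, (rule q).Below K' := by
    intro q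
    cases rule q with
    | eq i j => exact ⟨i + j + 1, fun K' h => ⟨by omega, by omega⟩⟩
    | succ i j => exact ⟨i + j + 1, fun K' h => ⟨by omega, by omega⟩⟩
    | lab i x => exact ⟨i + 1, fun K' h => h⟩
    | guess b i q => exact ⟨i + 1, fun K' h => h⟩
    | branch => exact ⟨0, fun _ _ => trivial⟩
    | call => exact ⟨0, fun _ _ => trivial⟩
  choose K hK using h
  obtain ⟨N, hN⟩ := (Set.finite_range K).bddAbove
  exact ⟨N, fun q => hK q N (hN ⟨q, rfl⟩)⟩

/-- Transitions of the machine evaluating a register program. The head moves freely in every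
state except when it checks a successor. -/
inductive EvalStep {α Q : Type} {K : ℕ} (rule : Q → Rule α Q) (q₀ : Q) :
    EvalState Q → Cell α K → Act (Cell α K) → EvalState Q → Prop
  | start (γ) : EvalStep rule q₀ .start γ (.write (none, Set.univ)) (.node q₀ false)
  | left (q b γ) : (b = true → ∀ i j, rule q ≠ .succ i j) →
      EvalStep rule q₀ (.node q b) γ .left (.node q b)
  | right (q b γ) : (b = true → ∀ i j, rule q ≠ .succ i j) →
      EvalStep rule q₀ (.node q b) γ .right (.node q b)
  | eq {q γ i j} : rule q = .eq i j → γ.Marks i → γ.Marks j →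
      EvalStep rule q₀ (.node q false) γ (.write γ) .accept
  | lab {q γ i x} : rule q = .lab i x → γ.Marks i → γ.1 = x →
      EvalStep rule q₀ (.node q false) γ (.write γ) .accept
  | succ {q γ i j} : rule q = .succ i j → γ.Marks i →
      EvalStep rule q₀ (.node q false) γ .right (.node q true)
  | succ_check {q γ i j} : rule q = .succ i j → γ.Marks j →
      EvalStep rule q₀ (.node q true) γ (.write γ) .accept
  | branch {q γ b r s} : rule q = .branch b r s →
      EvalStep rule q₀ (.node q false) γ (.write γ) (.node q true)
  | branch_left {q γ b r s} : rule q = .branch b r s →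
      EvalStep rule q₀ (.node q true) γ (.write γ) (.node r false)
  | branch_right {q γ b r s} : rule q = .branch b r s →
      EvalStep rule q₀ (.node q true) γ (.write γ) (.node s false)
  | guess {q γ b i r} : rule q = .guess b i r → γ.Marks i →
      EvalStep rule q₀ (.node q false) γ (.write (γ.erase i)) (.node q true)
  | guess_put {q γ b i r} : rule q = .guess b i r →
      EvalStep rule q₀ (.node q true) γ (.write (γ.put i)) (.node r false)

/-- The alternating Turing machine evaluating a register program. -/
def evalATM {α Q : Type} [Finite α] [Finite Q] (K : ℕ) (rule : Q → Rule α Q) (q₀ : Q) :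
    ATM α (Cell α K) where
  ΓFin := inferInstance
  emb := ⟨fun a => (some (some a), ∅), fun a b h => by simpa using h⟩
  blank := (some none, ∅)
  blank_ne := fun a h => by cases congrArg Prod.fst h
  Q := EvalState Q
  QFin := inferInstance
  isE
    | .start => true
    | .accept => false
    | .node _ false => true
    | .node q true => (rule q).isExistential
  start := .start
  δ := EvalStep rule q₀

section evalATM

variable {α Q : Type} [Finite α] [Finite Q] {K : ℕ} {rule : Q → Rule α Q} {q₀ : Q} {w : List α}

theorem init_cells (n : ℕ) (f : ℕ → Cell α K)
    (hf : f = (((evalATM K rule q₀).init w).2.cells (evalATM K rule q₀).blank).2) :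
    update f 0 (none, Set.univ) n = encodeTape K w (fun _ => 0) n := by
  subst hf
  rcases n with _ | n
  · refine Prod.ext rfl (Set.ext fun k => ?_)
    simp [encodeTape]
  · simp only [ne_eq, Nat.add_eq_zero_iff, one_ne_zero, and_false, not_false_eq_true,
      update_of_ne]
    rcases lt_or_ge n w.length with h | h
    · simp [ATM.init, Tape.cells, encodeTape, label, evalATM, h]
      rfl
    · simp [ATM.init, Tape.cells, encodeTape, label, evalATM, h]

/-- Configurations of the evaluating machine, presented by cell contents. -/
abbrev EvalCfg (α Q : Type) (K : ℕ) : Type := EvalState Q × ℕ × (ℕ → Cell α K)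

variable (K rule q₀) in
/-- Acceptance for the evaluating machine, presented by cell contents. -/
def EvalAccepted (c : EvalCfg α Q K) : Prop :=
  ATMPaper.Accepted (fun c : EvalCfg α Q K => (evalATM K rule q₀).isE c.1)
    (evalATM K rule q₀).CellYield c

theorem EvalStep.cellYield {s s' : EvalState Q} {a : Act (Cell α K)} {p : ℕ} {f : ℕ → Cell α K}
    (h : EvalStep rule q₀ s (f p) a s') :
    (evalATM K rule q₀).CellYield (s, p, f) (s', moveCells a (p, f)) :=
  ⟨a, h, rfl⟩

theorem EvalAccepted.of_step {s s' : EvalState Q} {a : Act (Cell α K)} {p : ℕ}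
    {f : ℕ → Cell α K} (hE : (evalATM K rule q₀).isE s = true) (hs : EvalStep rule q₀ s (f p) a s')
    (h : EvalAccepted K rule q₀ (s', moveCells a (p, f))) : EvalAccepted K rule q₀ (s, p, f) :=
  .of_step_existential hE hs.cellYield h

/-- Acceptance in an existential phase does not depend on the head position. -/
theorem EvalAccepted.move {q : Q} {b : Bool} {f : ℕ → Cell α K}
    (hE : (evalATM K rule q₀).isE (.node q b) = true)
    (hs : b = true → ∀ i j, rule q ≠ .succ i j) {p : ℕ}
    (h : EvalAccepted K rule q₀ (.node q b, p, f)) (p' : ℕ) :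
    EvalAccepted K rule q₀ (.node q b, p', f) := by
  have down : ∀ d p, EvalAccepted K rule q₀ (.node q b, p, f) →
      EvalAccepted K rule q₀ (.node q b, p + d, f) := by
    intro d
    induction d with
    | zero => exact fun p h => h
    | succ d ih =>
      intro p h
      exact .of_step_existential hE (EvalStep.left _ _ _ hs).cellYield (ih p h)
  have up : ∀ d p, EvalAccepted K rule q₀ (.node q b, p + d, f) →
      EvalAccepted K rule q₀ (.node q b, p, f) := by
    intro d
    induction d with
    | zero => exact fun p h => h
    | succ d ih =>
      intro p h
      refine .of_step_existential hE (EvalStep.right _ _ _ hs).cellYield (ih (p + 1) ?_)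
      rwa [add_right_comm]
  rcases le_total p p' with h' | h'
  · obtain ⟨d, rfl⟩ := Nat.exists_eq_add_of_le h'
    exact down d p h
  · obtain ⟨d, rfl⟩ := Nat.exists_eq_add_of_le h'
    exact up d p' h

theorem evalAccepted_accept (c : ℕ × (ℕ → Cell α K)) : EvalAccepted K rule q₀ (.accept, c) := by
  refine .of_universal_invariant (S := fun c => c.1 = .accept) ?_ rfl
  rintro ⟨_, c⟩ rfl
  refine ⟨rfl, ?_⟩
  rintro c' ⟨a, h, -⟩
  cases h

/-- The universal second phase of a branching or guessing rule is accepted if all its exits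
are. -/
theorem EvalAccepted.of_universal {q : Q} (hU : (evalATM K rule q₀).isE (.node q true) = false)
    {f : ℕ → Cell α K}
    (h : ∀ p c, (evalATM K rule q₀).CellYield (.node q true, p, f) c →
      c.1 ≠ .node q true → EvalAccepted K rule q₀ c)
    (p : ℕ) : EvalAccepted K rule q₀ (.node q true, p, f) := by
  refine .of_universal_invariant (S := fun c => c.1 = .node q true ∧ c.2.2 = f) ?_ ⟨rfl, rfl⟩
  rintro ⟨_, p, _⟩ ⟨rfl, rfl⟩
  refine ⟨hU, fun c hc => ?_⟩
  by_cases hq : c.1 = .node q true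
  · refine .inl ⟨hq, ?_⟩
    obtain ⟨a, h₁, h₂⟩ := hc
    rw [h₂]
    rw [hq] at h₁
    cases h₁ <;> rfl
  · exact .inr (h p c hc hq)

theorem evalAccepted_of_holds (hK : ∀ q, (rule q).Below K) (hcall : ∀ q P, rule q ≠ .call P)
    {q : Q} {ρ : ℕ → ℕ} (h : Holds rule w q ρ) (p : ℕ) :
    EvalAccepted K rule q₀ (.node q false, p, encodeTape K w ρ) := by
  refine h (fun q ρ => ∀ p, EvalAccepted K rule q₀ (.node q false, p, encodeTape K w ρ)) ?_ p
  intro q ρ h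
  have hq := hK q
  have start {p : ℕ} {a s} (h₁ : EvalStep rule q₀ (.node q false) (encodeTape K w ρ p) a s)
      (h₂ : EvalAccepted K rule q₀ (s, moveCells a (p, encodeTape K w ρ))) (p') :
      EvalAccepted K rule q₀ (.node q false, p', encodeTape K w ρ) := by
    refine EvalAccepted.move (p := p) rfl (by simp) ?_ p'
    exact .of_step_existential rfl h₁.cellYield h₂
  cases hr : rule q with
  | call P => exact (hcall _ _ hr).elim
  | eq i j =>
    rw [hr] at h hq
    exact start (.eq hr ((marks_encodeTape hq.1).2 rfl) ((marks_encodeTape hq.2).2 h.symm))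
      (evalAccepted_accept _)
  | lab i x =>
    rw [hr] at h hq
    exact start (.lab hr ((marks_encodeTape hq).2 rfl) h) (evalAccepted_accept _)
  | succ i j =>
    rw [hr] at h hq
    refine start (.succ hr ((marks_encodeTape hq.1).2 rfl)) ?_
    refine .of_step_existential (by simp [evalATM, Rule.isExistential, hr])
      (EvalStep.succ_check hr ((marks_encodeTape hq.2).2 h)).cellYield (evalAccepted_accept _)
  | branch b r s =>
    rw [hr] at h
    refine start (p := 0) (.branch hr) ?_
    simp only [moveCells, update_eq_self]
    cases b with
    | true =>
      have hE : (evalATM K rule q₀).isE (.node q true) = true := by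
        simp [evalATM, Rule.isExistential, hr]
      rcases h with h | h
      · refine .of_step hE (.branch_left hr) ?_
        simpa only [moveCells, update_eq_self] using h 0
      · refine .of_step hE (.branch_right hr) ?_
        simpa only [moveCells, update_eq_self] using h 0
    | false =>
      refine EvalAccepted.of_universal (by simp [evalATM, Rule.isExistential, hr]) ?_ 0
      rintro p ⟨s, pf⟩ ⟨a, h₁, h₂⟩ hne
      dsimp only at h₁ h₂ hne
      subst h₂
      cases h₁ with
      | left => exact (hne rfl).elim
      | right => exact (hne rfl).elim
      | branch_left hr' =>
        cases hr.symm.trans hr'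
        simp only [moveCells, update_eq_self]
        exact h.1 p
      | branch_right hr' =>
        cases hr.symm.trans hr'
        simp only [moveCells, update_eq_self]
        exact h.2 p
      | succ_check hr' => cases hr.symm.trans hr'
      | guess_put hr' => cases hr.symm.trans hr'
  | guess b i r =>
    rw [hr] at h hq
    refine start (.guess hr ((marks_encodeTape hq).2 rfl)) ?_
    simp only [moveCells, update_encodeTape_erase]
    cases b with
    | true =>
      obtain ⟨n, hn⟩ := h
      have hE : (evalATM K rule q₀).isE (.node q true) = true := by
        simp [evalATM, Rule.isExistential, hr]
      refine EvalAccepted.move (p := n) hE (by simp [hr]) ?_ _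
      refine .of_step hE (.guess_put hr) ?_
      simpa only [moveCells, update_erase_put] using hn n
    | false =>
      refine EvalAccepted.of_universal (by simp [evalATM, Rule.isExistential, hr]) ?_ _
      rintro p ⟨s, pf⟩ ⟨a, h₁, h₂⟩ hne
      dsimp only at h₁ h₂ hne
      subst h₂
      cases h₁ with
      | left => exact (hne rfl).elim
      | right => exact (hne rfl).elim
      | guess_put hr' =>
        cases hr.symm.trans hr'
        simp only [moveCells, update_erase_put]
        exact h p p
      | succ_check hr' => cases hr.symm.trans hr'
      | branch_left hr' => cases hr.symm.trans hr'
      | branch_right hr' => cases hr.symm.trans hr'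

/-- The meaning of a configuration of the evaluating machine on input `w`. -/
def EvalMeaning (rule : Q → Rule α Q) (q₀ : Q) (w : List α) : EvalCfg α Q K → Prop
  | (.start, p, f) => p = 0 →
      update f 0 (none, Set.univ) = encodeTape K w (fun _ => 0) → Holds rule w q₀ fun _ => 0
  | (.accept, _) => True
  | (.node q false, _, f) => ∀ ρ, f = encodeTape K w ρ → Holds rule w q ρ
  | (.node q true, p, f) => match rule q with
    | .succ _ j => ∀ ρ, f = encodeTape K w ρ → ρ j = p
    | .branch b r s => ∀ ρ, f = encodeTape K w ρ → (Rule.branch b r s).Sem w (Holds rule w) ρ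
    | .guess b i r => ∀ ρ, (f = fun n => (encodeTape K w ρ n).erase i) →
        (Rule.guess b i r).Sem w (Holds rule w) ρ
    | _ => True

theorem evalMeaning_of_step (hK : ∀ q, (rule q).Below K) (c c' : EvalCfg α Q K)
    (hE : (evalATM K rule q₀).isE c.1 = true) (h : (evalATM K rule q₀).CellYield c c')
    (h' : EvalMeaning rule q₀ w c') : EvalMeaning rule q₀ w c := by
  obtain ⟨s, p, f⟩ := c
  obtain ⟨s', p', f'⟩ := c'
  obtain ⟨a, h, hm⟩ := h
  dsimp only at h hm
  cases h with
  | start γ =>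
    cases hm
    rintro rfl hf
    exact h' _ hf
  | left q b γ hs =>
    cases hm
    cases b with
    | false => exact h'
    | true =>
      cases hr : rule q <;> simp_all [EvalMeaning]
  | right q b γ hs =>
    cases hm
    cases b with
    | false => exact h'
    | true =>
      cases hr : rule q <;> simp_all [EvalMeaning]
  | eq hr h₁ h₂ =>
    rintro ρ rfl
    have hq := hK ‹Q›
    rw [hr] at hq
    refine Holds.mk ?_
    rw [hr]
    exact ((marks_encodeTape hq.1).1 h₁).trans ((marks_encodeTape hq.2).1 h₂).symm
  | lab hr h₁ h₂ =>
    rintro ρ rfl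
    have hq := hK ‹Q›
    rw [hr] at hq
    refine Holds.mk ?_
    rw [hr]
    have := (marks_encodeTape hq).1 h₁
    subst this
    exact h₂
  | succ hr h₁ =>
    rintro ρ rfl
    have hq := hK ‹Q›
    rw [hr] at hq
    cases hm
    refine Holds.mk ?_
    simp only [EvalMeaning, hr] at h' ⊢
    have := (marks_encodeTape hq.1).1 h₁
    subst this
    exact h' ρ rfl
  | succ_check hr h₁ =>
    have hq := hK ‹Q›
    simp only [EvalMeaning, hr] at hq ⊢
    rintro ρ rfl
    exact (marks_encodeTape hq.2).1 h₁
  | branch hr =>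
    rintro ρ rfl
    cases hm
    refine Holds.mk ?_
    simp only [EvalMeaning, hr] at h' ⊢
    exact h' ρ (by simp)
  | @branch_left _ _ b _ _ hr =>
    cases hm
    simp only [EvalMeaning, hr] at h' ⊢
    rintro ρ rfl
    obtain rfl : b = true := by simpa [evalATM, hr, Rule.isExistential] using hE
    exact .inl (h' ρ (by simp))
  | @branch_right _ _ b _ _ hr =>
    cases hm
    simp only [EvalMeaning, hr] at h' ⊢
    rintro ρ rfl
    obtain rfl : b = true := by simpa [evalATM, hr, Rule.isExistential] using hE
    exact .inr (h' ρ (by simp))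
  | @guess q _ _ _ _ hr h₁ =>
    rintro ρ rfl
    have hq := hK q
    rw [hr] at hq
    cases hm
    refine Holds.mk ?_
    simp only [EvalMeaning, hr] at h' ⊢
    have := (marks_encodeTape hq).1 h₁
    subst this
    exact h' ρ update_encodeTape_erase
  | @guess_put _ _ b _ _ hr =>
    cases hm
    simp only [EvalMeaning, hr] at h' ⊢
    rintro ρ rfl
    obtain rfl : b = true := by simpa [evalATM, hr, Rule.isExistential] using hE
    exact ⟨p, h' _ (update_erase_put p)⟩

theorem uChain_move {q : Q} (hU : (evalATM K rule q₀).isE (.node q true) = false)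
    (hs : ∀ i j, rule q ≠ .succ i j) (f : ℕ → Cell α K) (p p' : ℕ) {c : EvalCfg α Q K}
    (h : UChain (fun c : EvalCfg α Q K => (evalATM K rule q₀).isE c.1)
      (evalATM K rule q₀).CellYield (.node q true, p', f) c) :
    UChain (fun c : EvalCfg α Q K => (evalATM K rule q₀).isE c.1)
      (evalATM K rule q₀).CellYield (.node q true, p, f) c := by
  rcases le_total p p' with h' | h'
  · induction h' using Nat.decreasingInduction with
    | self => exact h
    | of_succ k _ ih => exact .step hU (EvalStep.right _ _ _ fun _ => hs).cellYield ih
  · induction p, h' using Nat.le_induction with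
    | base => exact h
    | succ k _ ih => exact .step hU (EvalStep.left _ _ _ fun _ => hs).cellYield ih

theorem exists_uPivot_of_not_evalMeaning (c : EvalCfg α Q K)
    (hU : (evalATM K rule q₀).isE c.1 = false) (h : ¬ EvalMeaning rule q₀ w c) :
    ∃ c', UPivot (fun c : EvalCfg α Q K => (evalATM K rule q₀).isE c.1)
      (evalATM K rule q₀).CellYield c c' ∧ ¬ EvalMeaning rule q₀ w c' := by
  obtain ⟨_ | _ | ⟨q, _ | _⟩, p, f⟩ := c
  · simp [evalATM] at hU
  · simp [EvalMeaning] at h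
  · simp [evalATM] at hU
  · cases hr : rule q with
    | branch b r s =>
      obtain rfl : b = false := by simpa [evalATM, hr, Rule.isExistential] using hU
      simp only [EvalMeaning, hr, not_forall, Rule.Sem, not_and_or] at h
      obtain ⟨ρ, rfl, h | h⟩ := h
      · refine ⟨(.node r false, p, encodeTape K w ρ),
          ⟨.step hU ?_ (.refl _), rfl⟩, fun h' => h (h' ρ rfl)⟩
        have step := (EvalStep.branch_left hr).cellYield (q₀ := q₀) (p := p)
          (f := encodeTape K w ρ)
        simp only [moveCells, update_eq_self] at step
        exact step
      · refine ⟨(.node s false, p, encodeTape K w ρ),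
          ⟨.step hU ?_ (.refl _), rfl⟩, fun h' => h (h' ρ rfl)⟩
        have step := (EvalStep.branch_right hr).cellYield (q₀ := q₀) (p := p)
          (f := encodeTape K w ρ)
        simp only [moveCells, update_eq_self] at step
        exact step
    | guess b i r =>
      obtain rfl : b = false := by simpa [evalATM, hr, Rule.isExistential] using hU
      simp only [EvalMeaning, hr, not_forall, Rule.Sem] at h
      obtain ⟨ρ, rfl, n, h⟩ := h
      refine ⟨(.node r false, n, encodeTape K w (update ρ i n)),
        ⟨uChain_move hU (by simp [hr]) _ p n (.step hU ?_ (.refl _)), rfl⟩,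
        fun h' => h (h' _ rfl)⟩
      have step := (EvalStep.guess_put hr).cellYield (q₀ := q₀) (p := n)
        (f := fun n => (encodeTape K w ρ n).erase i)
      simp only [moveCells, update_erase_put] at step
      exact step
    | _ => simp [evalATM, hr, Rule.isExistential] at hU

theorem accepts_evalATM_iff (hK : ∀ q, (rule q).Below K) (hcall : ∀ q P, rule q ≠ .call P)
    (w : List α) : (evalATM K rule q₀).Accepts w ↔ Holds rule w q₀ fun _ => 0 := by
  unfold ATM.Accepts
  rw [ATM.accepted_iff_cells]
  have hinit : update (((evalATM K rule q₀).init w).2.cells (evalATM K rule q₀).blank).2 0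
      (none, Set.univ) = encodeTape K w (fun _ => 0) := funext fun n => init_cells n _ rfl
  constructor
  · intro h
    exact Accepted.sound (P := EvalMeaning rule q₀ w) (evalMeaning_of_step hK)
      exists_uPivot_of_not_evalMeaning h rfl hinit
  · intro h
    refine .of_step_existential rfl
      (c' := (.node q₀ false, 0, encodeTape K w fun _ => 0)) ⟨_, .start _, ?_⟩
      (evalAccepted_of_holds hK hcall h 0)
    exact Prod.ext rfl hinit.symm

end evalATM

theorem exists_ATM_of_definable {α : Type} [Finite α] {P : List α → (ℕ → ℕ) → Prop}
    (hP : Definable P) :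
    ∃ (Γ : Type) (M : ATM α Γ), {w | P w fun _ => 0} = M.Lang := by
  obtain ⟨Q, hQ, rule, q, h₁, h₂⟩ := hP
  obtain ⟨K, hK⟩ := Rule.exists_below rule
  refine ⟨_, evalATM K rule q, Set.ext fun w => ?_⟩
  exact (h₂ w _).symm.trans (accepts_evalATM_iff hK h₁ w).symm

end ATMPaper

namespace ATMPaper

open Function

/-- Relations definable uniformly in the registers holding their arguments. -/
def DefinableRel {α : Type} {n : ℕ} (R : List α → (Fin n → ℕ) → Prop) : Prop :=
  ∀ v : Fin n → ℕ, Definable fun w ρ => R w fun i => ρ (v i)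

/-- The least relation containing `A a` and closed under the rule deriving `(n, y)` as soon as for
each `x` some `(n', y')` related to it by `S a n y x` is derived. -/
inductive LeastFix (A : (Fin 3 → ℕ) → Prop) (S : (Fin 6 → ℕ) → Prop) (a : ℕ) : ℕ → ℕ → Prop
  | base {n y : ℕ} : A ![a, n, y] → LeastFix A S a n y
  | step {n y : ℕ} (f g : ℕ → ℕ) : (∀ x, S ![a, n, y, x, f x, g x]) →
      (∀ x, LeastFix A S a (f x) (g x)) → LeastFix A S a n y

theorem LeastFix.step_exists {A : (Fin 3 → ℕ) → Prop} {S : (Fin 6 → ℕ) → Prop} {a n y : ℕ}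
    (h : ∀ x, ∃ n' y', S ![a, n, y, x, n', y'] ∧ LeastFix A S a n' y') : LeastFix A S a n y := by
  choose f g h using h
  exact .step f g (fun x => (h x).1) fun x => (h x).2

/-- The graph of an iteration with parameter `a`, initial values `B a` and successor values
`S a n`. -/
inductive Iterate (B : (Fin 2 → ℕ) → Prop) (S : (Fin 4 → ℕ) → Prop) (a : ℕ) : ℕ → ℕ → Prop
  | zero {y : ℕ} : B ![a, y] → Iterate B S a 0 y
  | succ {n z y : ℕ} : Iterate B S a n z → S ![a, n, z, y] → Iterate B S a (n + 1) y

theorem Iterate.zero_iff {B : (Fin 2 → ℕ) → Prop} {S : (Fin 4 → ℕ) → Prop} {a y : ℕ} :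
    Iterate B S a 0 y ↔ B ![a, y] :=
  ⟨fun h => by cases h; assumption, .zero⟩

theorem Iterate.succ_iff {B : (Fin 2 → ℕ) → Prop} {S : (Fin 4 → ℕ) → Prop} {a n y : ℕ} :
    Iterate B S a (n + 1) y ↔ ∃ z, Iterate B S a n z ∧ S ![a, n, z, y] :=
  ⟨fun h => by cases h; exact ⟨_, ‹_›, ‹_›⟩, fun ⟨_, h, h'⟩ => .succ h h'⟩

namespace DefinableRel

variable {α : Type} {n m : ℕ} {R R' : List α → (Fin n → ℕ) → Prop}

theorem of_iff (h : DefinableRel R) (h' : ∀ w x, R w x ↔ R' w x) : DefinableRel R' :=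
  fun v => (h v).of_iff fun _ _ => h' _ _

theorem reindex (h : DefinableRel R) (σ : Fin n → Fin m) :
    DefinableRel fun w x => R w fun i => x (σ i) :=
  fun v => h fun i => v (σ i)

theorem and (h : DefinableRel R) (h' : DefinableRel R') : DefinableRel fun w x => R w x ∧ R' w x :=
  fun v => (h v).and (h' v)

theorem or (h : DefinableRel R) (h' : DefinableRel R') : DefinableRel fun w x => R w x ∨ R' w x :=
  fun v => (h v).or (h' v)

theorem exists_fresh_register (v : Fin n → ℕ) : ∃ k, ∀ i d, v i ≠ k + d := by
  obtain ⟨N, hN⟩ := (Set.finite_range v).bddAbove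
  exact ⟨N + 1, fun i d => by have := hN ⟨i, rfl⟩; omega⟩

theorem exists_cons {R : List α → (Fin (n + 1) → ℕ) → Prop} (h : DefinableRel R) :
    DefinableRel fun w x => ∃ z, R w (Matrix.vecCons z x) := by
  intro v
  obtain ⟨k, hk⟩ := exists_fresh_register v
  have hk' : ∀ i, v i ≠ k := fun i => hk i 0
  refine Definable.exists_fresh (P := fun w ρ z => R w (Matrix.vecCons z fun i => ρ (v i))) k
    (by simp [hk']) ((h (Matrix.vecCons k v)).of_iff fun w ρ => ?_)
  refine iff_of_eq (congrArg _ (funext fun i => ?_))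
  refine Fin.cases ?_ (fun i => ?_) i <;> simp

theorem forall_cons {R : List α → (Fin (n + 1) → ℕ) → Prop} (h : DefinableRel R) :
    DefinableRel fun w x => ∀ z, R w (Matrix.vecCons z x) := by
  intro v
  obtain ⟨k, hk⟩ := exists_fresh_register v
  have hk' : ∀ i, v i ≠ k := fun i => hk i 0
  refine Definable.forall_fresh (P := fun w ρ z => R w (Matrix.vecCons z fun i => ρ (v i))) k
    (by simp [hk']) ((h (Matrix.vecCons k v)).of_iff fun w ρ => ?_)
  refine iff_of_eq (congrArg _ (funext fun i => ?_))
  refine Fin.cases ?_ (fun i => ?_) i <;> simp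

theorem eq (i j : Fin n) : DefinableRel fun (_ : List α) x => x i = x j :=
  fun v => .eq (v i) (v j)

theorem succ (i j : Fin n) : DefinableRel fun (_ : List α) x => x j = x i + 1 :=
  fun v => .succ (v i) (v j)

theorem lab (i : Fin n) (a : Option (Option α)) : DefinableRel fun w x => label w (x i) = a :=
  fun v => .lab (v i) a

theorem eq_zero (i : Fin n) : DefinableRel fun (_ : List α) x => x i = 0 :=
  (lab i none).of_iff fun w x => by cases x i <;> simp [label]

/-- The register program computing a least fixed point, working on the registers from `k` on. -/
def leastFixRule (A : List α → (Fin 3 → ℕ) → Prop) (S : List α → (Fin 6 → ℕ) → Prop) (k : ℕ) :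
    Fin 13 → Rule α (Fin 13) :=
  ![.branch true 9 1, .guess false (k + 3) 2, .guess true (k + 4) 3, .guess true (k + 5) 4,
    .branch false 10 5, .guess true (k + 1) 6, .branch false 11 7, .guess true (k + 2) 8,
    .branch false 12 0,
    .call fun w ρ => A w ![ρ k, ρ (k + 1), ρ (k + 2)],
    .call fun w ρ => S w ![ρ k, ρ (k + 1), ρ (k + 2), ρ (k + 3), ρ (k + 4), ρ (k + 5)],
    .eq (k + 1) (k + 4), .eq (k + 2) (k + 5)]

theorem holds_leastFixRule_iff {A : List α → (Fin 3 → ℕ) → Prop}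
    {S : List α → (Fin 6 → ℕ) → Prop} {k : ℕ} {w : List α} {ρ : ℕ → ℕ} :
    Holds (leastFixRule A S k) w 0 ρ ↔
      LeastFix (A w) (S w) (ρ k) (ρ (k + 1)) (ρ (k + 2)) := by
  set L := LeastFix (A w) (S w)
  constructor
  · intro h
    refine h ![fun ρ => L (ρ k) (ρ (k + 1)) (ρ (k + 2)),
      fun ρ => ∀ x, ∃ n y, S w ![ρ k, ρ (k + 1), ρ (k + 2), x, n, y] ∧ L (ρ k) n y,
      fun ρ => ∃ n y, S w ![ρ k, ρ (k + 1), ρ (k + 2), ρ (k + 3), n, y] ∧ L (ρ k) n y,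
      fun ρ => ∃ y, S w ![ρ k, ρ (k + 1), ρ (k + 2), ρ (k + 3), ρ (k + 4), y] ∧
        L (ρ k) (ρ (k + 4)) y,
      fun ρ => S w ![ρ k, ρ (k + 1), ρ (k + 2), ρ (k + 3), ρ (k + 4), ρ (k + 5)] ∧
        L (ρ k) (ρ (k + 4)) (ρ (k + 5)),
      fun ρ => L (ρ k) (ρ (k + 4)) (ρ (k + 5)),
      fun ρ => ρ (k + 1) = ρ (k + 4) ∧ L (ρ k) (ρ (k + 1)) (ρ (k + 5)),
      fun ρ => L (ρ k) (ρ (k + 1)) (ρ (k + 5)),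
      fun ρ => ρ (k + 2) = ρ (k + 5) ∧ L (ρ k) (ρ (k + 1)) (ρ (k + 2)),
      fun ρ => A w ![ρ k, ρ (k + 1), ρ (k + 2)],
      fun ρ => S w ![ρ k, ρ (k + 1), ρ (k + 2), ρ (k + 3), ρ (k + 4), ρ (k + 5)],
      fun ρ => ρ (k + 1) = ρ (k + 4),
      fun ρ => ρ (k + 2) = ρ (k + 5)] ?_
    intro q ρ h
    fin_cases q <;> simp [leastFixRule, Rule.Sem] at h ⊢
    · exact h.elim .base .step_exists
    all_goals exact h
  · intro h
    generalize ha : ρ k = a at h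
    generalize hn : ρ (k + 1) = n at h
    generalize hy : ρ (k + 2) = y at h
    induction h generalizing ρ with
    | base h =>
      subst ha hn hy
      exact .mk (Or.inl (.mk h))
    | step f g hS hL ih =>
      subst ha hn hy
      refine .mk (Or.inr (.mk fun x => .mk (Exists.intro (f x) (.mk (Exists.intro (g x)
        (.mk (And.intro (.mk ?_) (.mk (Exists.intro (f x) (.mk (And.intro (.mk ?_)
        (.mk (Exists.intro (g x) (.mk (And.intro (.mk ?_) (ih x ?_ ?_ ?_))))))))))))))))
      · simpa [leastFixRule, Rule.Sem] using hS x
      all_goals simp [leastFixRule, Rule.Sem]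

theorem leastFix {A : List α → (Fin 3 → ℕ) → Prop} {S : List α → (Fin 6 → ℕ) → Prop}
    (hA : DefinableRel A) (hS : DefinableRel S) :
    DefinableRel fun w (x : Fin 3 → ℕ) => LeastFix (A w) (S w) (x 0) (x 1) (x 2) := by
  intro v
  obtain ⟨k, hk⟩ := exists_fresh_register v
  have key : Definable fun w ρ => LeastFix (A w) (S w) (ρ k) (ρ (k + 1)) (ρ (k + 2)) := by
    refine (Definable.of_program (leastFixRule A S k) ?_ 0).of_iff
      fun w ρ => holds_leastFixRule_iff
    intro q P h
    fin_cases q <;> simp [leastFixRule] at h <;> subst h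
    · refine (hA ![k, k + 1, k + 2]).of_iff fun w ρ => ?_
      refine iff_of_eq (congrArg _ (funext fun i => ?_))
      fin_cases i <;> rfl
    · refine (hS ![k, k + 1, k + 2, k + 3, k + 4, k + 5]).of_iff fun w ρ => ?_
      refine iff_of_eq (congrArg _ (funext fun i => ?_))
      fin_cases i <;> rfl
  have h₀ : ∀ i, v i ≠ k := fun i => hk i 0
  have h₁ : ∀ i, v i ≠ k + 1 := fun i => hk i 1
  have h₂ : ∀ i, v i ≠ k + 2 := fun i => hk i 2
  have key' : Definable fun w ρ => ∃ a, a = ρ (v 0) ∧ ∃ n, n = ρ (v 1) ∧ ∃ y, y = ρ (v 2) ∧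
      LeastFix (A w) (S w) a n y := by
    refine Definable.exists_fresh
      (P := fun w ρ a => a = ρ (v 0) ∧ ∃ n, n = ρ (v 1) ∧ ∃ y, y = ρ (v 2) ∧
        LeastFix (A w) (S w) a n y) k (by simp [h₀]) ((Definable.eq _ _).and ?_)
    refine Definable.exists_fresh
      (P := fun w ρ n => n = ρ (v 1) ∧ ∃ y, y = ρ (v 2) ∧
        LeastFix (A w) (S w) (ρ k) n y) (k + 1) (by simp [h₁]) ((Definable.eq _ _).and ?_)
    exact Definable.exists_fresh
      (P := fun w ρ y => y = ρ (v 2) ∧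
        LeastFix (A w) (S w) (ρ k) (ρ (k + 1)) y) (k + 2) (by simp [h₂])
        ((Definable.eq _ _).and key)
  exact key'.of_iff fun w ρ => by simp

theorem iterate {B : List α → (Fin 2 → ℕ) → Prop} {S : List α → (Fin 4 → ℕ) → Prop}
    (hB : DefinableRel B) (hS : DefinableRel S) :
    DefinableRel fun w (x : Fin 3 → ℕ) => Iterate (B w) (S w) (x 0) (x 1) (x 2) := by
  refine (leastFix (A := fun w x => x 1 = 0 ∧ B w ![x 0, x 2])
    (S := fun w x => x 1 = x 4 + 1 ∧ S w ![x 0, x 4, x 5, x 2]) ?_ ?_).of_iff fun w x => ?_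
  · refine (eq_zero 1).and ((hB.reindex ![0, 2]).of_iff fun w x => ?_)
    exact iff_of_eq (congrArg _ (funext fun i => by fin_cases i <;> rfl))
  · refine (succ 4 1).and ((hS.reindex ![0, 4, 5, 2]).of_iff fun w x => ?_)
    exact iff_of_eq (congrArg _ (funext fun i => by fin_cases i <;> rfl))
  · generalize x 0 = a, x 1 = n, x 2 = y
    constructor
    · intro h
      induction h with
      | base h =>
        obtain ⟨h₁, h₂⟩ := h
        simp only [Matrix.cons_val] at h₁ h₂
        subst h₁
        exact .zero h₂
      | step f g h₁ _ ih =>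
        obtain ⟨h₁, h₂⟩ := h₁ 0
        simp only [Matrix.cons_val] at h₁ h₂
        rw [h₁]
        exact .succ (ih 0) h₂
    · intro h
      induction h with
      | zero h => exact .base ⟨rfl, h⟩
      | succ h h' ih => exact .step_exists fun _ => ⟨_, _, ⟨rfl, h'⟩, ih⟩

theorem add : DefinableRel fun (_ : List α) (x : Fin 3 → ℕ) => x 2 = x 0 + x 1 := by
  refine (iterate (eq 1 0) (succ 2 3)).of_iff fun w x => ?_
  generalize x 2 = y
  induction x 1 generalizing y with
  | zero => simp [Iterate.zero_iff]
  | succ n ih => simp [Iterate.succ_iff, ih, add_assoc]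

theorem mul : DefinableRel fun (_ : List α) (x : Fin 3 → ℕ) => x 2 = x 0 * x 1 := by
  refine (iterate (eq_zero 1) (add.reindex ![2, 0, 3])).of_iff fun w x => ?_
  generalize x 2 = y
  induction x 1 generalizing y with
  | zero => simp [Iterate.zero_iff]
  | succ n ih =>
    rw [Iterate.succ_iff]
    simp_rw [ih]
    simp [mul_add]

theorem lt (i j : Fin n) : DefinableRel fun (_ : List α) x => x i < x j := by
  have h : DefinableRel fun (_ : List α) (x : Fin 2 → ℕ) => ∃ z t, z = x 0 + t ∧ x 1 = z + 1 :=
    exists_cons (R := fun _ (x : Fin 3 → ℕ) => ∃ t, x 0 = x 1 + t ∧ x 2 = x 0 + 1)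
      (exists_cons (R := fun _ (x : Fin 4 → ℕ) => x 1 = x 2 + x 0 ∧ x 3 = x 1 + 1)
        ((add.reindex ![2, 0, 1]).and (succ 1 3)))
  refine (h.reindex ![i, j]).of_iff fun w x => ?_
  simp only [Matrix.cons_val]
  exact ⟨fun ⟨z, t, hz, ht⟩ => by omega, fun h => ⟨x j - 1, x j - x i - 1, by omega, by omega⟩⟩

theorem natPair : DefinableRel fun (_ : List α) (x : Fin 3 → ℕ) => x 2 = Nat.pair (x 0) (x 1) := by
  have h₁ : DefinableRel fun (_ : List α) (x : Fin 3 → ℕ) =>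
      ∃ p, p = x 1 * x 1 ∧ x 2 = p + x 0 :=
    exists_cons (R := fun _ (x : Fin 4 → ℕ) => x 0 = x 2 * x 2 ∧ x 3 = x 0 + x 1)
      ((mul.reindex ![2, 2, 0]).and (add.reindex ![0, 1, 3]))
  have h₂ : DefinableRel fun (_ : List α) (x : Fin 3 → ℕ) =>
      ∃ p q, p = x 0 * x 0 ∧ q = p + x 0 ∧ x 2 = q + x 1 :=
    exists_cons (R := fun _ (x : Fin 4 → ℕ) => ∃ q, x 0 = x 1 * x 1 ∧ q = x 0 + x 1 ∧
      x 3 = q + x 2)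
      (exists_cons (R := fun _ (x : Fin 5 → ℕ) => x 1 = x 2 * x 2 ∧ x 0 = x 1 + x 2 ∧
        x 4 = x 0 + x 3)
        ((mul.reindex ![2, 2, 1]).and ((add.reindex ![1, 2, 0]).and (add.reindex ![0, 3, 4]))))
  refine (((lt 0 1).and h₁).or (((lt 1 0).or (eq 0 1)).and h₂)).of_iff fun w x => ?_
  rw [Nat.pair]
  split_ifs with h
  · simp [h, h.not_gt, h.ne]
  · simp [h, (not_lt.1 h).lt_or_eq.imp_right Eq.symm]

theorem comp_natPair {f : ℕ →. ℕ}
    (hf : DefinableRel fun (_ : List α) (x : Fin 2 → ℕ) => x 1 ∈ f (x 0)) :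
    DefinableRel fun (_ : List α) (x : Fin 3 → ℕ) => x 2 ∈ f (Nat.pair (x 0) (x 1)) :=
  (exists_cons (R := fun _ (x : Fin 4 → ℕ) => x 0 = Nat.pair (x 1) (x 2) ∧ x 3 ∈ f (x 0))
    ((natPair.reindex ![1, 2, 0]).and (hf.reindex ![0, 3]))).of_iff fun w x => by simp

/-- Graphs of partial recursive functions are definable. -/
theorem of_partrec {f : ℕ →. ℕ} (hf : Nat.Partrec f) :
    DefinableRel fun (_ : List α) (x : Fin 2 → ℕ) => x 1 ∈ f (x 0) := by
  have pair_left : DefinableRel fun (_ : List α) (x : Fin 2 → ℕ) => ∃ z, x 0 = Nat.pair (x 1) z :=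
    exists_cons (R := fun _ (x : Fin 3 → ℕ) => x 1 = Nat.pair (x 2) (x 0))
      (natPair.reindex ![2, 0, 1])
  have pair_right : DefinableRel fun (_ : List α) (x : Fin 2 → ℕ) => ∃ z, x 0 = Nat.pair z (x 1) :=
    exists_cons (R := fun _ (x : Fin 3 → ℕ) => x 1 = Nat.pair (x 0) (x 2))
      (natPair.reindex ![0, 2, 1])
  induction hf with
  | zero => exact (eq_zero 1).of_iff fun w x => by simp [pure, PFun.pure]
  | succ => exact (succ 0 1).of_iff fun w x => by simp
  | left =>
    refine pair_left.of_iff fun w x => ?_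
    simp only [PFun.coe_val, Part.mem_some_iff]
    exact ⟨fun ⟨z, h⟩ => by simp [h], fun h => ⟨(x 0).unpair.2, by simp [h]⟩⟩
  | right =>
    refine pair_right.of_iff fun w x => ?_
    simp only [PFun.coe_val, Part.mem_some_iff]
    exact ⟨fun ⟨z, h⟩ => by simp [h], fun h => ⟨(x 0).unpair.1, by simp [h]⟩⟩
  | @pair f g _ _ hf hg =>
    have h : DefinableRel fun (_ : List α) (x : Fin 2 → ℕ) =>
        ∃ y z, y ∈ f (x 0) ∧ z ∈ g (x 0) ∧ x 1 = Nat.pair y z :=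
      exists_cons (R := fun _ (x : Fin 3 → ℕ) => ∃ z, x 0 ∈ f (x 1) ∧ z ∈ g (x 1) ∧
        x 2 = Nat.pair (x 0) z)
        (exists_cons (R := fun _ (x : Fin 4 → ℕ) => x 1 ∈ f (x 2) ∧ x 0 ∈ g (x 2) ∧
          x 3 = Nat.pair (x 1) (x 0))
          ((hf.reindex ![2, 1]).and ((hg.reindex ![2, 0]).and (natPair.reindex ![1, 0, 3]))))
    refine h.of_iff fun w x => ?_
    simp [Seq.seq, eq_comm]
  | @comp f g _ _ hf hg =>
    refine (exists_cons (R := fun _ (x : Fin 3 → ℕ) => x 0 ∈ g (x 1) ∧ x 2 ∈ f (x 0))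
      ((hg.reindex ![1, 0]).and (hf.reindex ![0, 2]))).of_iff fun w x => ?_
    exact (Part.mem_bind_iff (f := g (x 0)) (g := f)).symm
  | @prec f g _ _ hf hg =>
    have step : DefinableRel fun (_ : List α) (x : Fin 4 → ℕ) =>
        x 3 ∈ g (Nat.pair (x 0) (Nat.pair (x 1) (x 2))) :=
      (exists_cons (R := fun _ (x : Fin 5 → ℕ) => ∃ r, r = Nat.pair (x 2) (x 3) ∧
        x 0 = Nat.pair (x 1) r ∧ x 4 ∈ g (x 0))
        (exists_cons (R := fun _ (x : Fin 6 → ℕ) => x 0 = Nat.pair (x 3) (x 4) ∧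
          x 1 = Nat.pair (x 2) (x 0) ∧ x 5 ∈ g (x 1))
          ((natPair.reindex ![3, 4, 0]).and
            ((natPair.reindex ![2, 0, 1]).and (hg.reindex ![1, 5]))))).of_iff fun w x => by simp
    have h : DefinableRel fun (_ : List α) (x : Fin 2 → ℕ) => ∃ a n, x 0 = Nat.pair a n ∧
        Iterate (fun x => x 1 ∈ f (x 0))
          (fun x => x 3 ∈ g (Nat.pair (x 0) (Nat.pair (x 1) (x 2)))) a n (x 1) :=
      exists_cons (R := fun _ (x : Fin 3 → ℕ) => ∃ n, x 1 = Nat.pair (x 0) n ∧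
        Iterate (fun x => x 1 ∈ f (x 0))
          (fun x => x 3 ∈ g (Nat.pair (x 0) (Nat.pair (x 1) (x 2)))) (x 0) n (x 2))
        (exists_cons (R := fun _ (x : Fin 4 → ℕ) => x 2 = Nat.pair (x 1) (x 0) ∧
          Iterate (fun x => x 1 ∈ f (x 0))
            (fun x => x 3 ∈ g (Nat.pair (x 0) (Nat.pair (x 1) (x 2)))) (x 1) (x 0) (x 3))
          ((natPair.reindex ![1, 0, 2]).and ((iterate hf step).reindex ![1, 0, 3])))
    refine h.of_iff fun w x => ?_
    have key : ∀ a n y, Iterate (fun x => x 1 ∈ f (x 0))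
        (fun x => x 3 ∈ g (Nat.pair (x 0) (Nat.pair (x 1) (x 2)))) a n y ↔
        y ∈ (n.rec (f a) fun m IH => IH.bind fun i => g (Nat.pair a (Nat.pair m i)) :
          Part ℕ) := by
      intro a n
      induction n with
      | zero => simp [Iterate.zero_iff]
      | succ n ih =>
        intro y
        rw [Iterate.succ_iff]
        simp_rw [ih]
        exact Part.mem_bind_iff.symm
    simp_rw [key]
    constructor
    · rintro ⟨a, n, h₁, h₂⟩
      rw [h₁]
      simpa [Nat.unpaired] using h₂
    · intro h
      exact ⟨_, _, (Nat.pair_unpair _).symm, h⟩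
  | @rfind f _ hf =>
    have value := comp_natPair hf
    have zero : DefinableRel fun (_ : List α) (x : Fin 2 → ℕ) =>
        ∃ z, z = 0 ∧ z ∈ f (Nat.pair (x 0) (x 1)) :=
      exists_cons (R := fun _ (x : Fin 3 → ℕ) => x 0 = 0 ∧ x 0 ∈ f (Nat.pair (x 1) (x 2)))
        ((eq_zero 0).and (value.reindex ![1, 2, 0]))
    have pos : DefinableRel fun (_ : List α) (x : Fin 2 → ℕ) =>
        ∃ t z, z = t + 1 ∧ z ∈ f (Nat.pair (x 0) (x 1)) :=
      exists_cons (R := fun _ (x : Fin 3 → ℕ) => ∃ z, z = x 0 + 1 ∧ z ∈ f (Nat.pair (x 1) (x 2)))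
        (exists_cons (R := fun _ (x : Fin 4 → ℕ) => x 0 = x 1 + 1 ∧
          x 0 ∈ f (Nat.pair (x 2) (x 3)))
          ((succ 1 0).and (value.reindex ![2, 3, 0])))
    have below : DefinableRel fun (_ : List α) (x : Fin 2 → ℕ) => ∀ m, (x 1 < m ∨ x 1 = m) ∨
        ∃ t z, z = t + 1 ∧ z ∈ f (Nat.pair (x 0) m) :=
      forall_cons (R := fun _ (x : Fin 3 → ℕ) => (x 2 < x 0 ∨ x 2 = x 0) ∨
        ∃ t z, z = t + 1 ∧ z ∈ f (Nat.pair (x 1) (x 0)))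
        (((lt 2 0).or (eq 2 0)).or (pos.reindex ![1, 0]))
    refine (zero.and below).of_iff fun w x => ?_
    refine Iff.trans ?_ Nat.mem_rfind.symm
    refine and_congr (by simp) (forall_congr' fun m => ?_)
    rw [← le_iff_lt_or_eq, ← not_lt, ← imp_iff_not_or]
    refine forall_congr' fun _ => ⟨?_, ?_⟩
    · rintro ⟨t, _, rfl, h⟩
      simpa using ⟨_, h, t.succ_ne_zero⟩
    · intro h
      obtain ⟨z, h, hz⟩ : ∃ z ∈ f (Nat.pair (x 0) m), z ≠ 0 := by simpa using h
      exact ⟨z - 1, z, by omega, h⟩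

theorem of_computable {f : ℕ → ℕ} (hf : Computable f) :
    DefinableRel fun (_ : List α) (x : Fin 2 → ℕ) => x 1 = f (x 0) :=
  (of_partrec (Partrec.nat_iff.1 hf)).of_iff fun w x => by simp

theorem of_computable₂ {f : ℕ → ℕ → ℕ} (hf : Computable₂ f) :
    DefinableRel fun (_ : List α) (x : Fin 3 → ℕ) => x 2 = f (x 0) (x 1) := by
  have h : Computable fun n : ℕ => f n.unpair.1 n.unpair.2 :=
    hf.comp (Computable.fst.comp Computable.unpair) (Computable.snd.comp Computable.unpair)
  exact (comp_natPair (of_partrec (Partrec.nat_iff.1 h))).of_iff fun w x => by simp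

end DefinableRel
end ATMPaper

namespace ATMPaper

open Encodable

namespace DefinableRel

variable {α : Type}

theorem exists_letter [Finite α] {n : ℕ} {R : α → List α → (Fin n → ℕ) → Prop}
    (h : ∀ a, DefinableRel (R a)) : DefinableRel fun w x => ∃ a, R a w x := by
  have key : ∀ l : List α, DefinableRel fun w x => ∃ a ∈ l, R a w x := by
    intro l
    induction l with
    | nil => exact fun v => (Definable.succ 0 0).of_iff fun w ρ => by simp
    | cons a l ih => exact ((h a).or ih).of_iff fun w x => by simp
  cases nonempty_fintype α
  exact (key Finset.univ.toList).of_iff fun w x => by simp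

/-- The code of the reversed input word is definable. -/
theorem encode_reverse [Finite α] [Primcodable α] :
    DefinableRel fun (w : List α) (x : Fin 1 → ℕ) => x 0 = encode w.reverse := by
  let push (a : α) (n : ℕ) : ℕ := encode (a :: (decode (α := List α) n).getD [])
  have hpush : ∀ a, Computable (push a) := fun a =>
    (Primrec.encode.comp (Primrec.list_cons.comp (Primrec.const a)
      (Primrec.option_getD.comp Primrec.decode (Primrec.const [])))).to_comp
  have step : DefinableRel fun w (x : Fin 4 → ℕ) =>
      ∃ a, w[x 1]? = some a ∧ x 3 = push a (x 2) :=
    exists_letter fun a =>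
      ((exists_cons (R := fun w (x : Fin 5 → ℕ) => x 0 = x 2 + 1 ∧
          label w (x 0) = some (some a)) ((succ 2 0).and (lab 0 _))).of_iff
        fun w x => by simp [label]).and ((of_computable (hpush a)).reindex ![2, 3])
  have hiter : ∀ (w : List α) a n y, Iterate (fun x => x 1 = 0)
      (fun x => ∃ a, w[x 1]? = some a ∧ x 3 = push a (x 2)) a n y ↔
      n ≤ w.length ∧ y = encode (w.take n).reverse := by
    intro w a n
    induction n with
    | zero => simp [Iterate.zero_iff]
    | succ n ih =>
      intro y
      rw [Iterate.succ_iff]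
      simp_rw [ih]
      constructor
      · rintro ⟨_, ⟨hn, rfl⟩, b, hb, hy⟩
        simp only [Matrix.cons_val] at hb hy
        refine ⟨(List.getElem?_eq_some_iff.1 hb).1, ?_⟩
        rw [hy, List.take_add_one, hb]
        simp [push]
      · rintro ⟨hn, rfl⟩
        refine ⟨_, ⟨by omega, rfl⟩, w[n], List.getElem?_eq_getElem hn, ?_⟩
        rw [List.take_add_one, List.getElem?_eq_getElem hn]
        simp [push, -List.take_append_getElem]
  refine (exists_cons (R := fun w (x : Fin 2 → ℕ) => ∃ p, p = x 0 + 1 ∧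
      label w p = some none ∧ Iterate (fun x => x 1 = 0)
        (fun x => ∃ a, w[x 1]? = some a ∧ x 3 = push a (x 2)) (x 0) (x 0) (x 1))
    (exists_cons (R := fun w (x : Fin 3 → ℕ) => x 0 = x 1 + 1 ∧
      label w (x 0) = some none ∧ Iterate (fun x => x 1 = 0)
        (fun x => ∃ a, w[x 1]? = some a ∧ x 3 = push a (x 2)) (x 1) (x 1) (x 2))
      ((succ 1 0).and ((lab 0 _).and
        ((iterate (eq_zero 1) step).reindex ![1, 1, 2]))))).of_iff fun w x => ?_
  simp only [Matrix.cons_val, hiter, exists_eq_left, label, Option.some.injEq,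
    List.getElem?_eq_none_iff]
  constructor
  · rintro ⟨n, h₁, h₂, h₃⟩
    rwa [List.take_of_length_le h₁] at h₃
  · exact fun h => ⟨w.length, le_rfl, le_rfl, by simpa using h⟩

end DefinableRel

/-- Lists (read backwards) all of whose infinite extensions have an initial segment in `R`. -/
inductive Barred {β : Type} (R : List β → Prop) : List β → Prop
  | base {l : List β} : R l.reverse → Barred R l
  | step {l : List β} : (∀ x, Barred R (x :: l)) → Barred R l

theorem barred_iff_forall_exists {β : Type} (R : List β → Prop) :
    (∀ x, Barred R [x]) ↔ ∀ f : ℕ → β, ∃ n, R ((List.range (n + 1)).map f) := by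
  constructor
  · intro h f
    have key : ∀ l, Barred R l → ∀ n, l = ((List.range (n + 1)).map f).reverse →
        ∃ n, R ((List.range (n + 1)).map f) := by
      intro l hl
      induction hl with
      | base h =>
        rintro n rfl
        exact ⟨n, by simpa using h⟩
      | step _ ih =>
        rintro n rfl
        exact ih (f (n + 1)) (n + 1) (by simp [List.range_succ])
    exact key _ (h (f 0)) 0 (by simp)
  · intro h
    by_contra! hx
    obtain ⟨x, hx⟩ := hx
    have hnext : ∀ l : {l // ¬ Barred R l}, ∃ x, ¬ Barred R (x :: l.1) := by
      intro l
      by_contra! h'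
      exact l.2 (.step h')
    choose next hnext using hnext
    let L (n : ℕ) : {l // ¬ Barred R l} := n.rec ⟨[x], hx⟩ fun _ l => ⟨next l :: l.1, hnext l⟩
    let f (n : ℕ) : β := n.casesOn x fun n => next (L n)
    have hL : ∀ n, (L n).1 = ((List.range (n + 1)).map f).reverse := by
      intro n
      induction n with
      | zero => rfl
      | succ n ih =>
        rw [List.range_succ, List.map_append, List.reverse_append, ← ih]
        rfl
    obtain ⟨n, hn⟩ := h f
    exact (L n).2 (.base (by rwa [hL, List.reverse_reverse]))

theorem IsInductive.exists_ATM {α : Type} [Finite α] [Primcodable α] {L : Set (List α)}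
    (hL : IsInductive α L) : ∃ (Γ : Type) (M : ATM α Γ), L = M.Lang := by
  obtain ⟨R, ⟨_, hR⟩, rfl⟩ := hL
  let word (n : ℕ) : List α := (decode n).getD []
  let list (n : ℕ) : List (List α) := (decode n).getD []
  have hword : Primrec word := Primrec.option_getD.comp Primrec.decode (Primrec.const [])
  have hlist : Primrec list := Primrec.option_getD.comp Primrec.decode (Primrec.const [])
  let check (c s : ℕ) : ℕ := encode (decide (R ((word c).reverse, (list s).reverse)))
  let push (s x : ℕ) : ℕ := encode (word x :: list s)
  have hcheck : Computable₂ check := Computable.encode.comp (hR.comp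
    (Computable.pair (Primrec.list_reverse.comp (hword.comp Primrec.fst)).to_comp
      (Primrec.list_reverse.comp (hlist.comp Primrec.snd)).to_comp))
  have hpush : Primrec₂ push := Primrec.encode.comp
    (Primrec.list_cons.comp (hword.comp Primrec.snd) (hlist.comp Primrec.fst))
  let A (x : Fin 3 → ℕ) : Prop := ∃ t z, z = 0 ∧ t = z + 1 ∧ t = check (x 0) (x 1)
  let S (x : Fin 6 → ℕ) : Prop := x 4 = push (x 1) (x 3)
  have hA : DefinableRel fun (_ : List α) => A :=
    .exists_cons (R := fun _ (x : Fin 4 → ℕ) => ∃ z, z = 0 ∧ x 0 = z + 1 ∧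
      x 0 = check (x 1) (x 2))
      (.exists_cons (R := fun _ (x : Fin 5 → ℕ) => x 0 = 0 ∧ x 1 = x 0 + 1 ∧
        x 1 = check (x 2) (x 3))
        ((DefinableRel.eq_zero 0).and ((DefinableRel.succ 0 1).and
          ((DefinableRel.of_computable₂ hcheck).reindex ![2, 3, 1]))))
  have hS : DefinableRel fun (_ : List α) => S :=
    (DefinableRel.of_computable₂ hpush.to_comp).reindex ![1, 3, 4]
  have root : DefinableRel fun w (_ : Fin 0 → ℕ) => ∃ c, c = encode w.reverse ∧
      ∀ x, ∃ s, s = push 0 x ∧ LeastFix A S c s s :=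
    .exists_cons (R := fun w (x : Fin 1 → ℕ) => x 0 = encode w.reverse ∧
      ∀ t, ∃ s, s = push 0 t ∧ LeastFix A S (x 0) s s)
      (DefinableRel.encode_reverse.and
        (.forall_cons (R := fun _ (x : Fin 2 → ℕ) => ∃ s, s = push 0 (x 0) ∧
          LeastFix A S (x 1) s s)
          (.exists_cons (R := fun _ (x : Fin 3 → ℕ) => x 0 = push 0 (x 1) ∧
            LeastFix A S (x 2) (x 0) (x 0))
            (((DefinableRel.of_computable
              (hpush.to_comp.comp (Computable.const 0) Computable.id)).reindex ![1, 0]).and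
              ((DefinableRel.leastFix hA hS).reindex ![2, 0, 0])))))
  have list_push : ∀ s x, list (push s x) = word x :: list s := by
    intro s x
    simp only [list, push, encodek, Option.getD_some]
  have key : ∀ w s y, LeastFix A S (encode (List.reverse w)) s y ↔
      Barred (fun l => R (w, l)) (list s) := by
    intro w s y
    have hA' : ∀ s y, A ![encode w.reverse, s, y] ↔ R (w, (list s).reverse) := by
      intro s y
      by_cases h : R (w, (list s).reverse) <;> simp [A, check, word, h]
    constructor
    · intro h
      induction h with
      | base h => exact .base ((hA' _ _).1 h)
      | step f g h _ ih =>
        refine .step fun x => ?_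
        have := ih (encode x)
        have hx := h (encode x)
        simp only [S, Matrix.cons_val] at hx
        rw [hx, list_push] at this
        simpa [word] using this
    · intro h
      generalize hl : list s = l at h
      induction h generalizing s y with
      | base h =>
        subst hl
        exact .base ((hA' _ _).2 h)
      | step _ ih =>
        subst hl
        exact .step (fun x => push s x) (fun _ => 0) (fun x => rfl)
          fun x => ih _ _ _ (list_push s x)
  obtain ⟨Γ, M, hM⟩ := exists_ATM_of_definable (root Fin.elim0)
  refine ⟨Γ, M, Eq.trans (Set.ext fun w => ?_) hM⟩
  simp only [Set.mem_ofPred_eq, exists_eq_left, key, list_push]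
  rw [← barred_iff_forall_exists fun l => R (w, l)]
  have hlist0 : list 0 = [] := by simp [list]
  rw [hlist0]
  exact ⟨fun h x => h _, fun h x => by simpa [word] using h (encode x)⟩

end ATMPaper

namespace ATMPaper

section Generic

variable {C : Type*} {isE : C → Bool} {step : C → C → Prop}

theorem not_accepted_of_rank {g : C → ℕ}
    (hE : ∀ c, g c ≠ 0 → isE c = true → ∀ c', step c c' → g c' ≠ 0)
    (hU : ∀ c, g c ≠ 0 → isE c = false → ∃ c', step c c' ∧ g c' ≠ 0 ∧ g c' < g c)
    {c : C} (hc : g c ≠ 0) : ¬ Accepted isE step c := by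
  refine fun h => hc (h.sound (P := fun c => g c = 0) ?_ ?_)
  · intro c c' h₁ h₂ h₃
    by_contra h₄
    exact hE c h₄ h₁ c' h₂ h₃
  · intro c h₁ h₂
    induction hn : g c using Nat.strong_induction_on generalizing c with
    | _ n ih =>
      obtain ⟨c', h₃, h₄, h₅⟩ := hU c h₂ h₁
      cases h₆ : isE c' with
      | true => exact ⟨c', ⟨.step h₁ h₃ (.refl _), h₆⟩, h₄⟩
      | false =>
        obtain ⟨d, h₇, h₈⟩ := ih _ (hn ▸ h₅) c' h₆ h₄ rfl
        exact ⟨d, ⟨.step h₁ h₃ h₇.1, h₇.2⟩, h₈⟩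

theorem UChain.accepted {c c' : C} (h : UChain isE step c c') (hc : Accepted isE step c)
    (hc' : isE c' = true) : Accepted isE step c' := by
  cases h with
  | refl => exact hc
  | step h₁ h₂ h₃ =>
    cases hc with
    | ex h₄ => simp [h₁] at h₄
    | univ _ h₄ => exact h₄ _ ⟨.step h₁ h₂ h₃, hc'⟩

variable (isE step) in
/-- `ReachesNonaccepted n c` says that from `c` a configuration that is existential and not
accepted is reachable by a chain of `n` steps, each leaving a universal configuration. -/
def ReachesNonaccepted : ℕ → C → Prop
  | 0, c => isE c = true ∧ ¬ Accepted isE step c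
  | n + 1, c => isE c = false ∧ ∃ c', step c c' ∧ ReachesNonaccepted n c'

theorem exists_reachesNonaccepted {c : C} :
    (∃ n, ReachesNonaccepted isE step n c) ↔ ¬ Accepted isE step c := by
  constructor
  · rintro ⟨n, hn⟩ h
    obtain ⟨c', h₁, h₂, h₃⟩ : ∃ c', UChain isE step c c' ∧ isE c' = true ∧
        ¬ Accepted isE step c' := by
      clear h
      induction n generalizing c with
      | zero => exact ⟨c, .refl c, hn⟩
      | succ n ih =>
        obtain ⟨h₁, c', h₂, h₃⟩ := hn
        obtain ⟨d, h₄, h₅⟩ := ih h₃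
        exact ⟨d, .step h₁ h₂ h₄, h₅⟩
    exact h₃ (h₁.accepted h h₂)
  · intro h
    cases hc : isE c with
    | true => exact ⟨0, hc, h⟩
    | false =>
      obtain ⟨c', ⟨h₁, h₂⟩, h₃⟩ : ∃ c', UPivot isE step c c' ∧ ¬ Accepted isE step c' := by
        by_contra! h'
        exact h (.univ hc h')
      clear h hc
      induction h₁ with
      | refl => exact ⟨0, h₂, h₃⟩
      | step h₄ h₅ _ ih =>
        obtain ⟨n, hn⟩ := ih h₃ h₂
        exact ⟨n + 1, h₄, _, h₅, hn⟩

/-- The configurations that are not accepted carry a rank witnessing this by local conditions. -/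
theorem exists_rank (isE : C → Bool) (step : C → C → Prop) :
    ∃ g : C → ℕ, (∀ c, g c ≠ 0 ↔ ¬ Accepted isE step c) ∧
      (∀ c, g c ≠ 0 → isE c = true → ∀ c', step c c' → g c' ≠ 0) ∧
      ∀ c, g c ≠ 0 → isE c = false → ∃ c', step c c' ∧ g c' ≠ 0 ∧ g c' < g c := by
  classical
  let g : C → ℕ := fun c =>
    if h : ∃ n, ReachesNonaccepted isE step n c then Nat.find h + 1 else 0
  have hg : ∀ c, g c ≠ 0 ↔ ¬ Accepted isE step c := fun c => by
    rw [← exists_reachesNonaccepted]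
    by_cases h : ∃ n, ReachesNonaccepted isE step n c <;> simp [g, h]
  refine ⟨g, hg, fun c h₁ h₂ c' h₃ => ?_, fun c h₁ h₂ => ?_⟩
  · rw [hg] at h₁ ⊢
    exact fun h => h₁ (h.of_step_existential h₂ h₃)
  · have h := exists_reachesNonaccepted.2 ((hg c).1 h₁)
    have hspec := Nat.find_spec h
    have hgc : g c = Nat.find h + 1 := dif_pos h
    cases hn : Nat.find h with
    | zero => rw [hn] at hspec; simp [hspec.1] at h₂
    | succ n =>
      rw [hn] at hspec
      obtain ⟨-, c', h₃, h₄⟩ := hspec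
      have h' : ∃ n, ReachesNonaccepted isE step n c' := ⟨n, h₄⟩
      have hgc' : g c' = Nat.find h' + 1 := dif_pos h'
      have := Nat.find_le (h := h') h₄
      exact ⟨c', h₃, by omega, by omega⟩

end Generic

section Coding

open Encodable

variable {α C : Type} [Primcodable C]

/-- The rank of a configuration recorded in a list of strings. -/
def rankIn (l : List (List α)) (c : C) : ℕ := (l.getD (encode c) []).length

/-- The recorded ranks violate the local conditions of a rank at `c`. -/
def RankDefect (isE : C → Bool) (succs : C → List C) (l : List (List α)) (c : C) : Prop :=
  rankIn l c ≠ 0 ∧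
    ((isE c = true ∧ ∃ c' ∈ succs c, rankIn l c' = 0) ∨
      (isE c = false ∧ ∀ c' ∈ succs c, rankIn l c' = 0 ∨ rankIn l c ≤ rankIn l c'))

/-- The strings in a list refute that they record a rank with nonzero value at `c`. -/
def RefutesRank (isE : C → Bool) (succs : C → List C) (l : List (List α)) (c : C) : Prop :=
  (encode c < l.length ∧ rankIn l c = 0) ∨
    ∃ c ∈ (List.range l.length).filterMap (decode (α := C)),
      (∀ c' ∈ c :: succs c, encode c' < l.length) ∧ RankDefect isE succs l c

theorem rankIn_map_range (f : ℕ → List α) {n : ℕ} {c : C} (h : encode c < n) :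
    rankIn ((List.range n).map f) c = (f (encode c)).length := by
  simp [rankIn, h]

theorem accepted_iff_refutesRank [Nonempty α] (isE : C → Bool) (succs : C → List C) (c : C) :
    Accepted isE (fun c c' => c' ∈ succs c) c ↔
      ∀ f : ℕ → List α, ∃ n, RefutesRank isE succs ((List.range (n + 1)).map f) c := by
  constructor
  · intro h f
    by_contra! hf
    have hlarge : ∀ s : List C, ∃ n, ∀ c ∈ s, encode c < n + 1 := fun s => by
      induction s with
      | nil => simp
      | cons c s ih =>
        obtain ⟨n, hn⟩ := ih
        refine ⟨max (encode c) n, fun d hd => ?_⟩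
        rcases List.mem_cons.1 hd with rfl | hd
        · omega
        · have := hn d hd
          omega
    let g : C → ℕ := fun c => (f (encode c)).length
    have key : ∀ c, g c ≠ 0 →
        (isE c = true → ∀ c' ∈ succs c, g c' ≠ 0) ∧
          (isE c = false → ∃ c' ∈ succs c, g c' ≠ 0 ∧ g c' < g c) := by
      intro c hc
      obtain ⟨n, hn⟩ := hlarge (c :: succs c)
      have hg : ∀ c' ∈ c :: succs c, rankIn ((List.range (n + 1)).map f) c' = g c' :=
        fun c' h' => rankIn_map_range f (hn c' h')
      have hdefect : ¬ RankDefect isE succs ((List.range (n + 1)).map f) c := by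
        refine fun h' => hf n (.inr ⟨c, ?_, by simpa using hn, h'⟩)
        rw [List.mem_filterMap]
        exact ⟨encode c, by simpa using hn c (by simp), encodek c⟩
      rw [RankDefect, hg c (by simp)] at hdefect
      constructor
      · intro h₁ c' h₂ h₃
        exact hdefect ⟨hc, .inl ⟨h₁, c', h₂, by rw [hg c' (by simp [h₂]), h₃]⟩⟩
      · intro h₁
        by_contra! h₂
        refine hdefect ⟨hc, .inr ⟨h₁, fun c' h₃ => ?_⟩⟩
        rw [hg c' (by simp [h₃])]
        exact or_iff_not_imp_left.2 (h₂ c' h₃)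
    refine not_accepted_of_rank (g := g) (fun c h₁ h₂ => (key c h₁).1 h₂)
      (fun c h₁ h₂ => (key c h₁).2 h₂) (fun h' => ?_) h
    refine hf (encode c) (.inl ⟨by simp, ?_⟩)
    rw [rankIn_map_range f (Nat.lt_succ_self _)]
    exact h'
  · intro h
    by_contra hc
    obtain ⟨g, hg, hE, hU⟩ := exists_rank isE fun c c' => c' ∈ succs c
    obtain ⟨a⟩ := ‹Nonempty α›
    obtain ⟨n, hn⟩ := h fun k => List.replicate (((decode (α := C) k).map g).getD 0) a
    have hval : ∀ c : C, encode c < n + 1 → rankIn ((List.range (n + 1)).map fun k =>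
        List.replicate (((decode (α := C) k).map g).getD 0) a) c = g c := fun c h' => by
      simp [rankIn_map_range _ h']
    rcases hn with ⟨h₁, h₂⟩ | ⟨d, -, h₁, h₂, h₃⟩
    · rw [hval c (by simpa using h₁)] at h₂
      exact (hg c).2 hc h₂
    · replace h₁ : ∀ c' ∈ d :: succs d, encode c' < n + 1 := by simpa using h₁
      have hd := hval d (h₁ d (by simp))
      rw [hd] at h₂ h₃
      rcases h₃ with ⟨h₄, c', h₅, h₆⟩ | ⟨h₄, h₅⟩
      · rw [hval c' (h₁ c' (by simp [h₅]))] at h₆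
        exact hE d h₂ h₄ c' h₅ h₆
      · obtain ⟨c', h₆, h₇, h₈⟩ := hU d h₂ h₄
        have := h₅ c' h₆
        rw [hval c' (h₁ c' (by simp [h₆]))] at this
        omega

open Primrec

variable [Primcodable α]

theorem primrec_rankIn : Primrec₂ (rankIn : List (List α) → C → ℕ) :=
  list_length.comp ((list_getD []).comp fst (Primrec.encode.comp snd))

variable {isE : C → Bool} {succs : C → List C}

theorem primrecRel_rankDefect (hE : Primrec isE) (hs : Primrec succs) :
    PrimrecRel (RankDefect (α := α) isE succs) := by
  have hv : Primrec fun p : List (List α) × C => rankIn p.1 p.2 := primrec_rankIn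
  have hsucc : Primrec fun p : List (List α) × C => succs p.2 := hs.comp snd
  have h₁ : PrimrecRel fun (c' : C) (p : List (List α) × C) => rankIn p.1 c' = 0 :=
    Primrec.eq.comp (primrec_rankIn.comp (fst.comp snd) fst) (const 0)
  have h₂ : PrimrecRel fun (c' : C) (p : List (List α) × C) =>
      rankIn p.1 c' = 0 ∨ rankIn p.1 p.2 ≤ rankIn p.1 c' :=
    h₁.or (nat_le.comp (hv.comp snd) (primrec_rankIn.comp (fst.comp snd) fst))
  exact (Primrec.eq.comp hv (const 0)).not.and
    (((Primrec.eq.comp (hE.comp snd) (const true)).and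
        (h₁.exists_mem_list.comp hsucc .id)).or
      ((Primrec.eq.comp (hE.comp snd) (const false)).and
        (h₂.forall_mem_list.comp hsucc .id)))

theorem primrecRel_refutesRank (hE : Primrec isE) (hs : Primrec succs) :
    PrimrecRel (RefutesRank (α := α) isE succs) := by
  have hlt : PrimrecRel fun (c : C) (l : List (List α)) => encode c < l.length :=
    nat_lt.comp (Primrec.encode.comp fst) (list_length.comp snd)
  have hbody : PrimrecRel fun (c : C) (l : List (List α)) =>
      (∀ c' ∈ c :: succs c, encode c' < l.length) ∧ RankDefect isE succs l c :=
    (hlt.forall_mem_list.comp (list_cons.comp fst (hs.comp fst)) snd).and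
      ((primrecRel_rankDefect hE hs).comp snd fst)
  exact ((hlt.comp snd fst).and (Primrec.eq.comp primrec_rankIn (const 0))).or
    (hbody.exists_mem_list.comp
      (listFilterMap (list_range.comp (list_length.comp fst)) (Primrec.decode.comp snd).to₂) fst)

theorem isInductive_accepted (hE : Primrec isE) (hs : Primrec succs) {init : List α → C}
    (hi : Primrec init) :
    IsInductive α {w | Accepted isE (fun c c' => c' ∈ succs c) (init w)} := by
  rcases isEmpty_or_nonempty α with hα | hα
  · refine ⟨fun _ => Accepted isE (fun c c' => c' ∈ succs c) (init []),
      ⟨fun _ => Classical.propDecidable _, Computable.const _⟩, ?_⟩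
    ext w
    simp [Subsingleton.elim w []]
  · exact ⟨fun p => RefutesRank isE succs p.2 (init p.1),
      ((primrecRel_refutesRank hE hs).comp snd (hi.comp fst)).computablePred,
      Set.ext fun w => accepted_iff_refutesRank isE succs (init w)⟩

end Coding

section Machine

open Primrec

variable {α Γ : Type}

/-- An action, coded by the written symbol, if any, and the direction otherwise. -/
def Act.equivOption : Act Γ ≃ Option (Option Γ) where
  toFun
    | .left => none
    | .right => some none
    | .write τ => some (some τ)
  invFun o := o.elim .left fun o => o.elim .right .write
  left_inv a := by cases a <;> rfl
  right_inv o := by rcases o with _ | _ | _ <;> rfl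

instance [Primcodable Γ] : Primcodable (Act Γ) := .ofEquiv _ Act.equivOption

instance [Finite Γ] : Finite (Act Γ) := .of_equiv _ Act.equivOption.symm

theorem primrec_tapeAct [Primcodable Γ] (blank : Γ) : Primrec₂ (Tape.act blank) := by
  have hu : Primrec fun t : Tape Γ => t.1 := fst
  have hγ : Primrec fun t : Tape Γ => t.2.1 := fst.comp snd
  have hv : Primrec fun t : Tape Γ => t.2.2 := snd.comp snd
  have hright : Primrec fun t : Tape Γ => (t.1 ++ [t.2.1], t.2.2.headD blank, t.2.2.tail) :=
    (list_append.comp hu (list_cons.comp hγ (const []))).pair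
      (((option_getD.comp (list_head?.comp hv) (const blank)).of_eq fun t => by simp).pair
        (list_tail.comp hv))
  have hrev := list_reverse.comp hu
  have hleft : Primrec fun t : Tape Γ => t.1.reverse.head?.elim t fun τ =>
      (t.1.reverse.tail.reverse, τ, t.2.1 :: t.2.2) :=
    (option_casesOn (list_head?.comp hrev) .id
      (((list_reverse.comp (list_tail.comp hrev)).comp fst).pair
        (snd.pair ((list_cons.comp hγ hv).comp fst))).to₂).of_eq fun t => by
          cases t.1.reverse.head? <;> rfl
  have hcode : Primrec fun p : Act Γ × Tape Γ => Act.equivOption p.1 :=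
    Primrec.of_equiv.comp fst
  refine (option_casesOn hcode (hleft.comp snd) (option_casesOn snd
    (hright.comp (snd.comp fst))
    (((hu.comp (snd.comp (fst.comp fst))).pair
      (snd.pair (hv.comp (snd.comp (fst.comp fst)))))).to₂).to₂).of_eq ?_
  rintro ⟨_ | _ | _, t⟩ <;> rfl

namespace ATM

variable (M : ATM α Γ)

theorem isInductive_lang [Primcodable α] [Finite α] : IsInductive α M.Lang := by
  obtain ⟨_, ⟨eΓ⟩⟩ := @Finite.exists_equiv_fin Γ M.ΓFin
  obtain ⟨_, ⟨eQ⟩⟩ := @Finite.exists_equiv_fin M.Q M.QFin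
  have := M.ΓFin
  have := M.QFin
  let _ : Primcodable Γ := .ofEquiv _ eΓ
  let _ : Primcodable M.Q := .ofEquiv _ eQ
  let moves : M.Q × Γ → List (Act Γ × M.Q) := fun c =>
    (Set.toFinite {p : Act Γ × M.Q | M.δ c.1 c.2 p.1 p.2}).toFinset.toList
  let succs : M.Cfg → List M.Cfg := fun c =>
    (moves (c.1, c.2.2.1)).map fun p => (p.2, c.2.act M.blank p.1)
  have hsuccs : Primrec succs :=
    list_map ((dom_finite moves).comp (fst.pair (fst.comp (snd.comp snd))))
      ((snd.comp snd).pair ((primrec_tapeAct M.blank).comp (fst.comp snd) (snd.comp fst))).to₂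
  have hE : Primrec M.cfgE := (dom_finite M.isE).comp fst
  have hinit : Primrec M.init :=
    (const M.start).pair ((const []).pair ((const M.blank).pair
      (list_map .id ((dom_finite M.emb).comp snd).to₂)))
  have hyield : M.Yield = fun c c' => c' ∈ succs c := by
    ext c ⟨q, t⟩
    simp [succs, moves, Yield, actStep_iff, Tape.scan, eq_comm]
  have h := isInductive_accepted hE hsuccs hinit
  rw [← hyield] at h
  exact h

end ATM

end Machine

end ATMPaper

open ATMPaper in
/-- a language `L ⊆ Σ*` is inductive (`Π¹₁`) iff it is accepted
by some alternating Turing machine over `Σ`. -/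
theorem stmt16 {α : Type} [Fintype α] [Primcodable α] (L : Set (List α)) :
    IsInductive α L ↔ ∃ (Γ : Type) (M : ATM α Γ), L = M.Lang :=
  ⟨fun h => h.exists_ATM, fun ⟨_, M, h⟩ => h ▸ M.isInductive_lang⟩
end

section
/- Let M₀ and M₁ be single-tape alternating Turing machines over the same input alphabet Σ and machine alphabet Γ, and let M be their combined two-tape machine. If M₀ accepts a configuration (q₀,u₀) and (q₁,u₁) is a configuration of M₁ that is not rejected by M₁, then M accepts the configuration (⟨q₀,q₁,0⟩, ⟨u₀,u₁⟩). Consequently, if no string is both accepted by M₀ and rejected by M₁, then M accepts every string accepted by M₀. -/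
namespace ATMPaper

section Generic

variable {C : Type*} {isE : C → Bool} {step : C → C → Prop}

/-- An existential configuration with an accepted successor is accepted. -/
theorem Accepted.of_step {c c' : C} (hc : isE c = true) (hs : step c c')
    (h : Accepted isE step c') : Accepted isE step c := by
  cases h with
  | ex h' hp ha => exact .ex hc ⟨.step hc hs hp.1, hp.2⟩ ha
  | univ h' hp => exact .ex hc ⟨.step hc hs (.refl _), h'⟩ (.univ h' hp)

/-- Every pivot of an accepted configuration along universal configurations is accepted. -/
theorem Accepted.of_uPivot {c c' : C} (h : Accepted isE step c)
    (hp : UPivot isE step c c') : Accepted isE step c' := by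
  cases hc : isE c with
  | false =>
    cases h with
    | ex h' _ _ => simp [hc] at h'
    | univ _ h' => exact h' _ hp
  | true =>
    obtain ⟨hch, -⟩ := hp
    cases hch with
    | refl => exact h
    | step h' _ _ => simp [hc] at h'

/-- A universal configuration all of whose successors are accepted is accepted. -/
theorem Accepted.of_forall_step {c : C} (hc : isE c = false)
    (h : ∀ c', step c c' → Accepted isE step c') : Accepted isE step c := by
  refine .univ hc fun c' hp => ?_
  obtain ⟨hch, he⟩ := hp
  cases hch with
  | refl => simp [hc] at he
  | step _ hs hch => exact (h _ hs).of_uPivot ⟨hch, he⟩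

/-- A universal configuration with a rejected successor is rejected. -/
theorem Rejected.of_step {c c' : C} (hc : isE c = false) (hs : step c c')
    (h : Rejected isE step c') : Rejected isE step c := by
  cases h with
  | ex h' hp => exact .univ hc ⟨.step hc hs (.refl _), h'⟩ (.ex h' hp)
  | univ h' hp hr => exact .univ hc ⟨.step hc hs hp.1, hp.2⟩ hr

end Generic

theorem ActStep.write_scan {Γ : Type} (b : Γ) (t : Tape Γ) :
    ActStep b (Act.write (Tape.scan t)) t t :=
  ActStep.write t.1 t.2.1 t.2.1 t.2.2

theorem ActStep.eq_of_write_scan {Γ : Type} {b : Γ} {t t' : Tape Γ}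
    (h : ActStep b (Act.write (Tape.scan t)) t t') : t' = t := by
  obtain ⟨u, γ, v⟩ := t
  cases h
  rfl

section Combine

variable {α Γ : Type} {M₀ M₁ : ATM α Γ}

/-- The configuration of the combined machine with components `c` and `d` and control `j`. -/
def combineCfg (c : M₀.Cfg) (d : M₁.Cfg) (j : Bool) : (combine M₀ M₁).Cfg :=
  ((c.1, d.1, j), c.2, d.2)

theorem cfgE_combineCfg_false (c : M₀.Cfg) (d : M₁.Cfg) :
    (combine M₀ M₁).cfgE (combineCfg c d false) = M₀.cfgE c := rfl

theorem cfgE_combineCfg_true (c : M₀.Cfg) (d : M₁.Cfg) :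
    (combine M₀ M₁).cfgE (combineCfg c d true) = M₁.cfgE d := rfl

theorem yield_combineCfg_false_iff {c : M₀.Cfg} {d : M₁.Cfg} {e : (combine M₀ M₁).Cfg} :
    (combine M₀ M₁).Yield (combineCfg c d false) e ↔
      ∃ c', M₀.Yield c c' ∧ e = combineCfg c' d (M₀.cfgE c || M₀.cfgE c') := by
  constructor
  · obtain ⟨q, t₀, t₁⟩ := e
    rintro ⟨a₀, a₁, ⟨-, p₀, hδ, rfl, hq⟩ | ⟨h, -⟩, h₀, h₁⟩
    · refine ⟨(p₀, t₀), ⟨a₀, hδ, h₀⟩, ?_⟩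
      have ht : t₁ = d.2 := ActStep.eq_of_write_scan h₁
      have hq' : q = _ := hq
      rw [hq', ht]
      simp [combineCfg, ATM.cfgE]
    · cases h
  · rintro ⟨c', ⟨a, hδ, ha⟩, rfl⟩
    refine ⟨a, _, Or.inl ⟨rfl, c'.1, hδ, rfl, ?_⟩, ha, ActStep.write_scan _ _⟩
    simp [combineCfg, ATM.cfgE]

theorem yield_combineCfg_true_iff (hb : M₀.blank = M₁.blank)
    {c : M₀.Cfg} {d : M₁.Cfg} {e : (combine M₀ M₁).Cfg} :
    (combine M₀ M₁).Yield (combineCfg c d true) e ↔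
      ∃ d', M₁.Yield d d' ∧ e = combineCfg c d' (M₁.cfgE d && M₁.cfgE d') := by
  have hblank : (combine M₀ M₁).blank = M₁.blank := hb
  unfold ATM2.Yield ATM.Yield
  rw [hblank]
  constructor
  · obtain ⟨q, t₀, t₁⟩ := e
    rintro ⟨a₀, a₁, ⟨h, -⟩ | ⟨-, p₁, hδ, rfl, hq⟩, h₀, h₁⟩
    · cases h
    · refine ⟨(p₁, t₁), ⟨a₁, hδ, h₁⟩, ?_⟩
      have ht : t₀ = c.2 := ActStep.eq_of_write_scan h₀
      have hq' : q = _ := hq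
      rw [hq', ht]
      rfl
  · rintro ⟨d', ⟨a, hδ, ha⟩, rfl⟩
    exact ⟨_, a, Or.inr ⟨rfl, d'.1, hδ, rfl, rfl⟩, ActStep.write_scan _ _, ha⟩

/-- If the combined machine accepts `c` in control `0` against every configuration that `M₁` does
not reject, then it also does so in control `1`. -/
theorem accepted_combineCfg_true (hb : M₀.blank = M₁.blank) {c : M₀.Cfg}
    (h : ∀ d, ¬M₁.Rejected d → (combine M₀ M₁).Accepted (combineCfg c d false))
    {d : M₁.Cfg} (hd : ¬M₁.Rejected d) :
    (combine M₀ M₁).Accepted (combineCfg c d true) := by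
  cases hE : M₁.cfgE d with
  | false =>
    refine Accepted.of_forall_step hE fun e he => ?_
    obtain ⟨d', hy, rfl⟩ := (yield_combineCfg_true_iff hb).1 he
    rw [hE, Bool.false_and]
    exact h d' fun hr => hd (Rejected.of_step hE hy hr)
  | true =>
    obtain ⟨d', ⟨hch, hU⟩, hd'⟩ :
        ∃ d', EPivot M₁.cfgE M₁.Yield d d' ∧ ¬M₁.Rejected d' := by
      by_contra! hall
      exact hd (Rejected.ex hE hall)
    rw [← hE]
    clear hd hE
    induction hch with
    | refl d => rw [hU]; exact h d hd'
    | step hE hy _ ih =>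
      rw [hE]
      refine Accepted.of_step hE ((yield_combineCfg_true_iff hb).2 ⟨_, hy, rfl⟩) ?_
      rw [hE, Bool.true_and]
      exact ih hd' hU

theorem accepted_combineCfg_false (hb : M₀.blank = M₁.blank) {c : M₀.Cfg}
    (hc : M₀.Accepted c) {d : M₁.Cfg} (hd : ¬M₁.Rejected d) :
    (combine M₀ M₁).Accepted (combineCfg c d false) := by
  induction hc generalizing d with
  | ex hc hp hac ih =>
    obtain ⟨hch, -⟩ := hp
    clear hac hc
    induction hch generalizing d with
    | refl => exact ih hd
    | step hE hy _ ih' =>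
      refine Accepted.of_step hE (yield_combineCfg_false_iff.2 ⟨_, hy, rfl⟩) ?_
      rw [hE, Bool.true_or]
      exact accepted_combineCfg_true hb (fun d hd => ih' ih hd) hd
  | @univ c hU hac ih =>
    refine Accepted.univ hU ?_
    rintro e ⟨hch, he⟩
    clear hac
    generalize hs : combineCfg c d false = s at hch
    induction hch generalizing c with
    | refl =>
      subst hs
      rw [cfgE_combineCfg_false, hU] at he
      cases he
    | step _ hy hch ih' =>
      subst hs
      obtain ⟨c', hy', rfl⟩ := yield_combineCfg_false_iff.1 hy
      rw [hU, Bool.false_or] at hch ih'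
      cases hE : M₀.cfgE c' with
      | false =>
        exact ih' hE (fun e hp _ hd => ih e ⟨.step hU hy' hp.1, hp.2⟩ hd) he (by rw [hE])
      | true =>
        rw [hE] at hch
        refine Accepted.of_uPivot ?_ ⟨hch, he⟩
        exact accepted_combineCfg_true hb
          (fun d hd => ih c' ⟨.step hU hy' (.refl _), hE⟩ hd) hd

end Combine

end ATMPaper

open ATMPaper in
/-- let `M` be the combined two-tape machine of single-tape
machines `M₀`, `M₁` over the same alphabets. If `M₀` accepts `(q₀,u₀)` and
`(q₁,u₁)` is a configuration of `M₁` not rejected by `M₁`, then `M` accepts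
`(⟨q₀,q₁,0⟩,⟨u₀,u₁⟩)`. Consequently, if no string is both accepted by `M₀`
and rejected by `M₁`, then `M` accepts every string accepted by `M₀`. -/
theorem stmt17 {α Γ : Type} (M₀ M₁ : ATM α Γ)
    (hb : M₀.blank = M₁.blank) (he : ∀ a : α, M₀.emb a = M₁.emb a) :
    (∀ (q₀ : M₀.Q) (u₀ : Tape Γ) (q₁ : M₁.Q) (u₁ : Tape Γ),
      M₀.Accepted (q₀, u₀) → ¬M₁.Rejected (q₁, u₁) →
        (combine M₀ M₁).Accepted ((q₀, q₁, false), u₀, u₁)) ∧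
    ((∀ w : List α, ¬(M₀.Accepts w ∧ M₁.Rejects w)) →
      ∀ w : List α, M₀.Accepts w → (combine M₀ M₁).Accepts w) := by
  have key : ∀ (q₀ : M₀.Q) (u₀ : Tape Γ) (q₁ : M₁.Q) (u₁ : Tape Γ),
      M₀.Accepted (q₀, u₀) → ¬M₁.Rejected (q₁, u₁) →
        (combine M₀ M₁).Accepted ((q₀, q₁, false), u₀, u₁) :=
    fun _ _ _ _ h₀ h₁ => accepted_combineCfg_false hb h₀ h₁
  refine ⟨key, fun hdisj w hw => key _ _ _ _ hw fun hr => hdisj w ⟨hw, ?_⟩⟩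
  have hemb : M₀.emb = M₁.emb := DFunLike.ext _ _ he
  change M₁.Rejected (M₁.start, [], M₀.blank, w.map M₀.emb) at hr
  rw [hb, hemb] at hr
  exact hr
end
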